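/- arXiv:2211.13158 — 7 statements merged into one kernel-verified Lean document; each statement's English description precedes it below -/
import Mathlib

section
/- Fix n ≥ 2 and a partition of {1,…,n} into pairwise disjoint sets J₊, J₋, J₀ with J₊ ≠ ∅ and J₋ ∪ J₀ ≠ ∅. Let p(x) = Σ_{i∈J₊} x_i² − Σ_{i∈J₋} x_i² and q(x) = Σ_{i∈J₊} x_i² − Σ_{i∈J₋} x_i² − (Σ_{i∈J₀} x_i²)². Then I²({x ∈ ℝⁿ : q(x) = 0}) = ⟨p⟩₂. -/
open MvPolynomial Filter Asymptotics Topology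

/-- `p ∈ Iᵐ(E)`: `p` has total degree at most `m` and there is a `Cᵐ` function `F`
vanishing everywhere on `E` with `F(v) - p(v) = o(‖v‖^m)` as `v → 0`, i.e. `p` is the
`m`-th degree Taylor polynomial of `F` at the origin. -/
def Im (n m : ℕ) (E : Set (Fin n → ℝ)) : Set (MvPolynomial (Fin n) ℝ) :=
  {p | p.totalDegree ≤ m ∧ ∃ F : (Fin n → ℝ) → ℝ, ContDiff ℝ m F ∧ (∀ x ∈ E, F x = 0) ∧
    (fun v => F v - eval v p) =o[𝓝 (0 : Fin n → ℝ)] (fun v => ‖v‖ ^ m)}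

/-- The truncated ideal `⟨ps⟩_m`: polynomials `p` of degree at most `m` such that for some
polynomials `qᵢ`, all monomials of degree at most `m` in `p - ∑ qᵢ · psᵢ` vanish. -/
def truncIdeal (n m : ℕ) {ι : Type} [Fintype ι] (ps : ι → MvPolynomial (Fin n) ℝ) :
    Set (MvPolynomial (Fin n) ℝ) :=
  {p | p.totalDegree ≤ m ∧ ∃ q : ι → MvPolynomial (Fin n) ℝ,
    ∀ d : Fin n →₀ ℕ, (d.sum fun _ e => e) ≤ m →
      coeff d (p - ∑ i, q i * ps i) = 0}

section SecondOrder

variable {E : Type*} [NormedAddCommGroup E] [NormedSpace ℝ E]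

lemma hasFDerivAt_zero_of_isLittleO_sq {G : E → ℝ} (h0 : G 0 = 0)
    (hG : G =o[𝓝 0] fun v => ‖v‖ ^ 2) : HasFDerivAt G (0 : E →L[ℝ] ℝ) 0 := by
  rw [hasFDerivAt_iff_isLittleO_nhds_zero]
  simp only [zero_add, h0, sub_zero, zero_apply]
  refine hG.trans ?_
  exact isLittleO_norm_pow_id one_lt_two

lemma hasStrictFDerivAt_fderiv_zero_of_isLittleO_sq {G : E → ℝ} (hc : ContDiff ℝ 2 G)
    (h0 : G 0 = 0) (hG : G =o[𝓝 0] fun v => ‖v‖ ^ 2) :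
    HasStrictFDerivAt (fderiv ℝ G) (0 : E →L[ℝ] E →L[ℝ] ℝ) 0 := by
  have hd : ContDiff ℝ 1 (fderiv ℝ G) := hc.fderiv_right (by norm_num)
  have hs := hd.contDiffAt.hasStrictFDerivAt (x := (0 : E)) one_ne_zero
  have hdiff : Differentiable ℝ G := hc.differentiable (by norm_num)
  set A := fderiv ℝ (fderiv ℝ G) 0
  suffices A = 0 by rwa [this] at hs
  ext v w
  simp only [zero_apply]
  have key : ∀ ε > 0, |A v w| ≤ ε * (‖v‖ * ‖w‖ + ‖v + w‖ ^ 2 + ‖v‖ ^ 2 + ‖w‖ ^ 2) := by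
    intro ε hε
    have h1 := hs.isLittleO.bound hε
    have h2 := hG.bound hε
    rw [show ((0 : E), (0 : E)) = (0 : E × E) from rfl] at h1
    obtain ⟨δ₁, hδ₁, h1⟩ := Metric.eventually_nhds_iff_ball.1 h1
    obtain ⟨δ₂, hδ₂, h2⟩ := Metric.eventually_nhds_iff_ball.1 h2
    obtain ⟨t, ht, htδ⟩ : ∃ t > 0, t * (‖v‖ + ‖w‖) < min δ₁ δ₂ := by
      have : 0 < ‖v‖ + ‖w‖ + 1 := by positivity
      refine ⟨min δ₁ δ₂ / (‖v‖ + ‖w‖ + 1), by positivity, ?_⟩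
      rw [div_mul_eq_mul_div, div_lt_iff₀ this]
      have : 0 < min δ₁ δ₂ := by positivity
      nlinarith
    obtain ⟨ht1, ht2⟩ := lt_min_iff.1 htδ
    have nt : ∀ x : E, ‖t • x‖ = t * ‖x‖ := fun x => by
      rw [norm_smul, Real.norm_of_nonneg ht.le]
    have hv0 := mul_nonneg ht.le (norm_nonneg v)
    have hw0 := mul_nonneg ht.le (norm_nonneg w)
    have hvw : ‖t • v + t • w‖ ≤ t * (‖v‖ + ‖w‖) := by
      refine (norm_add_le _ _).trans ?_
      rw [nt, nt, mul_add]
    have hder : ∀ x ∈ Metric.closedBall (0 : E) (t * ‖w‖),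
        HasFDerivWithinAt (fun x => G (t • v + x) - G x - A (t • v) x)
          (fderiv ℝ G (t • v + x) - fderiv ℝ G x - A (t • v))
          (Metric.closedBall (0 : E) (t * ‖w‖)) x := by
      intro x _
      have e1 : HasFDerivAt (fun x => G (t • v + x)) (fderiv ℝ G (t • v + x)) x :=
        (hasFDerivAt_comp_add_left _).2 (hdiff _).hasFDerivAt
      exact ((e1.sub (hdiff x).hasFDerivAt).sub (A (t • v)).hasFDerivAt).hasFDerivWithinAt
    have hbd : ∀ x ∈ Metric.closedBall (0 : E) (t * ‖w‖),
        ‖fderiv ℝ G (t • v + x) - fderiv ℝ G x - A (t • v)‖ ≤ ε * (t * ‖v‖) := by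
      intro x hx
      rw [mem_closedBall_zero_iff] at hx
      have hx' : ‖t • v + x‖ ≤ t * (‖v‖ + ‖w‖) := by
        refine (norm_add_le _ _).trans ?_
        rw [nt, mul_add]; gcongr
      have := h1 (t • v + x, x) (by
        rw [mem_ball_zero_iff, Prod.norm_mk]
        refine max_lt (by linarith) (by linarith))
      simpa [nt] using this
    have hm := (convex_closedBall (0 : E) (t * ‖w‖)).norm_image_sub_le_of_norm_hasFDerivWithin_le
      hder hbd (Metric.mem_closedBall_self hw0)
      (by rw [mem_closedBall_zero_iff, nt] : t • w ∈ Metric.closedBall (0 : E) (t * ‖w‖))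
    simp only [add_zero, h0, sub_zero, map_zero, map_smul, smul_apply, nt,
      smul_eq_mul, Real.norm_eq_abs] at hm
    have b1 := h2 (t • v + t • w) (by rw [mem_ball_zero_iff]; linarith)
    have b2 := h2 (t • v) (by rw [mem_ball_zero_iff, nt]; linarith)
    have b3 := h2 (t • w) (by rw [mem_ball_zero_iff, nt]; linarith)
    rw [← smul_add] at b1
    simp only [nt, norm_pow, Real.norm_eq_abs, abs_mul, abs_norm, abs_of_pos ht] at b1 b2 b3
    rw [smul_add] at b1
    rw [abs_le] at hm b1 b2 b3 ⊢
    have ht' : 0 < t ^ 2 := by positivity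
    constructor
    · refine le_of_mul_le_mul_left ?_ ht'
      nlinarith
    · refine le_of_mul_le_mul_left ?_ ht'
      nlinarith
  have hlim : Tendsto (fun ε : ℝ => ε * (‖v‖ * ‖w‖ + ‖v + w‖ ^ 2 + ‖v‖ ^ 2 + ‖w‖ ^ 2))
      (𝓝[>] 0) (𝓝 0) := by
    refine (Continuous.tendsto' (by fun_prop) _ _ (by simp)).mono_left nhdsWithin_le_nhds
  have := ge_of_tendsto hlim (eventually_mem_nhdsWithin.mono fun ε hε => key ε hε)
  exact abs_nonpos_iff.1 this

/-- Near the origin, the first and second symmetric differences of a `C²` function that is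
`o(‖v‖²)` are small relative to the increment. -/
lemma exists_symmetric_difference_bounds {G : E → ℝ} (hc : ContDiff ℝ 2 G)
    (h0 : G 0 = 0) (hG : G =o[𝓝 0] fun v => ‖v‖ ^ 2) {ε : ℝ} (hε : 0 < ε) :
    ∃ δ > 0, ∀ z h : E, ‖z‖ + ‖h‖ < δ →
      |G (z + h) - G (z - h)| ≤ ε * (‖z‖ + ‖h‖) * ‖h‖ ∧
      |G (z + h) + G (z - h) - 2 * G z| ≤ ε * ‖h‖ ^ 2 ∧
      |G (z + h)| ≤ ε * (‖z‖ + ‖h‖) ^ 2 := by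
  have hs := hasStrictFDerivAt_fderiv_zero_of_isLittleO_sq hc h0 hG
  have hdiff : Differentiable ℝ G := hc.differentiable (by norm_num)
  have hD0 : fderiv ℝ G 0 = 0 := (hasFDerivAt_zero_of_isLittleO_sq h0 hG).fderiv
  have h1 := hs.isLittleO.bound (half_pos hε)
  have h2 := hG.bound hε
  rw [show ((0 : E), (0 : E)) = (0 : E × E) from rfl] at h1
  obtain ⟨δ₁, hδ₁, h1⟩ := Metric.eventually_nhds_iff_ball.1 h1
  obtain ⟨δ₂, hδ₂, h2⟩ := Metric.eventually_nhds_iff_ball.1 h2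
  have hL : ∀ a b : E, ‖a‖ < δ₁ → ‖b‖ < δ₁ →
      ‖fderiv ℝ G a - fderiv ℝ G b‖ ≤ ε / 2 * ‖a - b‖ := by
    intro a b ha hb
    simpa using h1 (a, b) (by rw [mem_ball_zero_iff, Prod.norm_mk]; exact max_lt ha hb)
  refine ⟨min δ₁ δ₂, by positivity, fun z h hzh => ?_⟩
  obtain ⟨hz1, hz2⟩ := lt_min_iff.1 hzh
  have hz := norm_nonneg z
  have hh := norm_nonneg h
  refine ⟨?_, ?_, ?_⟩
  · have hbd : ∀ x ∈ Metric.closedBall (0 : E) (‖z‖ + ‖h‖),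
        ‖fderiv ℝ G x‖ ≤ ε / 2 * (‖z‖ + ‖h‖) := by
      intro x hx
      rw [mem_closedBall_zero_iff] at hx
      have := hL x 0 (by linarith) (by simpa using hδ₁)
      rw [hD0, sub_zero, sub_zero] at this
      exact this.trans (by gcongr)
    have := (convex_closedBall (0 : E) (‖z‖ + ‖h‖)).norm_image_sub_le_of_norm_fderiv_le
      (fun x _ => hdiff x) hbd
      (by rw [mem_closedBall_zero_iff]; exact norm_sub_le z h)
      (by rw [mem_closedBall_zero_iff]; exact norm_add_le z h)
    rw [Real.norm_eq_abs] at this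
    refine this.trans ?_
    have e : z + h - (z - h) = (2 : ℝ) • h := by rw [two_smul]; abel
    rw [e, norm_smul]
    norm_num
    apply le_of_eq; ring
  · have hder : ∀ x ∈ Metric.closedBall (0 : E) ‖h‖,
        HasFDerivWithinAt (fun x => G (z + x) + G (z - x))
          (fderiv ℝ G (z + x) - fderiv ℝ G (z - x)) (Metric.closedBall (0 : E) ‖h‖) x := by
      intro x _
      have e1 : HasFDerivAt (fun x => G (z + x)) (fderiv ℝ G (z + x)) x :=
        (hasFDerivAt_comp_add_left _).2 (hdiff _).hasFDerivAt
      have e2 : HasFDerivAt (fun x => G (z - x)) (-fderiv ℝ G (z - x)) x :=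
        by simpa [Function.comp_def] using
          (hdiff (z - x)).hasFDerivAt.comp x ((hasFDerivAt_id x).const_sub z)
      rw [sub_eq_add_neg]
      exact (e1.add e2).hasFDerivWithinAt
    have hbd : ∀ x ∈ Metric.closedBall (0 : E) ‖h‖,
        ‖fderiv ℝ G (z + x) - fderiv ℝ G (z - x)‖ ≤ ε * ‖h‖ := by
      intro x hx
      rw [mem_closedBall_zero_iff] at hx
      refine (hL _ _ ((norm_add_le _ _).trans_lt (by linarith))
        ((norm_sub_le _ _).trans_lt (by linarith))).trans ?_
      have e : z + x - (z - x) = (2 : ℝ) • x := by rw [two_smul]; abel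
      rw [e, norm_smul, Real.norm_ofNat]
      nlinarith
    have := (convex_closedBall (0 : E) ‖h‖).norm_image_sub_le_of_norm_hasFDerivWithin_le
      hder hbd (Metric.mem_closedBall_self hh)
      (by rw [mem_closedBall_zero_iff] : h ∈ Metric.closedBall (0 : E) ‖h‖)
    simp only [add_zero, sub_zero, Real.norm_eq_abs] at this
    rw [show G (z + h) + G (z - h) - 2 * G z = G (z + h) + G (z - h) - (G z + G z) by ring]
    exact this.trans (le_of_eq (by ring))
  · have hzh' := norm_add_le z h
    have := h2 (z + h) (by rw [mem_ball_zero_iff]; linarith)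
    rw [Real.norm_eq_abs, norm_pow, norm_norm] at this
    exact this.trans (by gcongr)

end SecondOrder

lemma eq_zero_of_abs_add_mul_le {α β γ : ℝ}
    (h : ∀ ε > 0, ∀ᶠ t in 𝓝[>] (0 : ℝ), |α + t * β + t ^ 3 * γ| ≤ ε * t) : α = 0 ∧ β = 0 := by
  have hα : α = 0 := by
    have l1 : Tendsto (fun t : ℝ => |α + t * β + t ^ 3 * γ| - t) (𝓝[>] 0) (𝓝 |α|) :=
      (Continuous.tendsto' (by fun_prop) _ _ (by simp)).mono_left nhdsWithin_le_nhds
    have := le_of_tendsto l1 ((h 1 one_pos).mono fun t ht => by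
      show _ ≤ (0 : ℝ)
      linarith)
    exact abs_nonpos_iff.1 this
  refine ⟨hα, ?_⟩
  subst hα
  have : ∀ ε > 0, |β| ≤ ε := by
    intro ε hε
    have l1 : Tendsto (fun t : ℝ => |β + t ^ 2 * γ|) (𝓝[>] 0) (𝓝 |β|) :=
      (Continuous.tendsto' (by fun_prop) _ _ (by simp)).mono_left nhdsWithin_le_nhds
    refine le_of_tendsto l1 ?_
    filter_upwards [h ε hε, eventually_mem_nhdsWithin] with t ht ht0
    have ht0 : 0 < t := ht0
    rw [show 0 + t * β + t ^ 3 * γ = t * (β + t ^ 2 * γ) by ring, abs_mul, abs_of_pos ht0,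
      mul_comm] at ht
    exact le_of_mul_le_mul_right ht ht0
  exact abs_nonpos_iff.1 (le_of_forall_pos_le_add fun ε hε => by simpa using this ε hε)

lemma exists_eval_eq_add_linear_add_bilinear {n : ℕ} (P : MvPolynomial (Fin n) ℝ)
    (hP : P.totalDegree ≤ 2) :
    ∃ (c : ℝ) (l : (Fin n → ℝ) →ₗ[ℝ] ℝ) (B : (Fin n → ℝ) →ₗ[ℝ] (Fin n → ℝ) →ₗ[ℝ] ℝ),
      ∀ v, eval v P = c + l v + B v v := by
  have hmon : ∀ d : Fin n →₀ ℕ, d.degree ≤ 2 → ∀ a : ℝ,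
      ∃ (c : ℝ) (l : (Fin n → ℝ) →ₗ[ℝ] ℝ) (B : (Fin n → ℝ) →ₗ[ℝ] (Fin n → ℝ) →ₗ[ℝ] ℝ),
      ∀ v, eval v (monomial d a) = c + l v + B v v := by
    have peel : ∀ d : Fin n →₀ ℕ, d ≠ 0 →
        ∃ d' i, d = d' + Finsupp.single i 1 ∧ d.degree = d'.degree + 1 := by
      intro d hd
      obtain ⟨i, hi⟩ := Finsupp.ne_iff.1 hd
      have hle : Finsupp.single i 1 ≤ d := by
        rw [Finsupp.single_le_iff]; exact Nat.one_le_iff_ne_zero.2 hi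
      have e := (tsub_add_cancel_of_le hle).symm
      refine ⟨d - Finsupp.single i 1, i, e, ?_⟩
      conv_lhs => rw [e]
      simp
    intro d hd a
    by_cases h0 : d = 0
    · exact ⟨a, 0, 0, fun v => by simp [h0]⟩
    obtain ⟨d', i, rfl, hd'⟩ := peel d h0
    by_cases h1 : d' = 0
    · exact ⟨0, a • LinearMap.proj i, 0, fun v => by simp [h1, eval_monomial]⟩
    obtain ⟨d'', j, rfl, hd''⟩ := peel d' h1
    have h2 : d'' = 0 := by
      rw [← Finsupp.degree_eq_zero_iff]; omega
    refine ⟨0, 0, a • (LinearMap.mul ℝ ℝ).compl₁₂ (LinearMap.proj i) (LinearMap.proj j),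
      fun v => ?_⟩
    simp [h2, monomial_eq, Finsupp.prod_add_index', pow_add, mul_comm]
  have hdeg : ∀ d ∈ P.support, d.degree ≤ 2 := fun d hd =>
    (le_totalDegree hd).trans hP
  choose! c l B h using fun d hd => hmon d hd (coeff d P)
  refine ⟨∑ d ∈ P.support, c d, ∑ d ∈ P.support, l d, ∑ d ∈ P.support, B d, fun v => ?_⟩
  conv_lhs => rw [P.as_sum, map_sum]
  rw [Finset.sum_congr rfl fun d hd => h d (hdeg d hd) v]
  simp [Finset.sum_add_distrib]

lemma sqrt_add_sq_mul_pos {a b t : ℝ} (ha : 0 ≤ a) (hb : 0 ≤ b) (hab : 0 < a + b) (ht : 0 < t) :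
    0 < √(a + t ^ 2 * b) := by
  apply Real.sqrt_pos.2
  rcases ha.lt_or_eq with h | h
  · positivity
  · have : 0 < b := by linarith
    positivity

section Curve

variable {E : Type*} [NormedAddCommGroup E] [NormedSpace ℝ E]

lemma eventually_curve_bounds {G : E → ℝ} (hc : ContDiff ℝ 2 G) (h0 : G 0 = 0)
    (hG : G =o[𝓝 0] fun v => ‖v‖ ^ 2) (u w : E) {a b : ℝ} (hb : 0 ≤ b) {ε : ℝ} (hε : 0 < ε) :
    ∀ᶠ t in 𝓝[>] (0 : ℝ),
      |G (t • w + (t * √(a + t ^ 2 * b)) • u) - G (t • w - (t * √(a + t ^ 2 * b)) • u)| ≤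
          ε * t * (t * √(a + t ^ 2 * b)) ∧
      |G (t • w + (t * √(a + t ^ 2 * b)) • u) + G (t • w - (t * √(a + t ^ 2 * b)) • u)
          - 2 * G (t • w)| ≤ ε * (t * √(a + t ^ 2 * b)) ^ 2 ∧
      |G (t • w + (t * √(a + t ^ 2 * b)) • u)| ≤ ε * t ^ 2 := by
  set K := √(a + b)
  have hK0 : 0 ≤ K := Real.sqrt_nonneg _
  set N := 1 + ‖w‖ + (1 + K) * ‖u‖ with hN
  have hwn := norm_nonneg w
  have hun := norm_nonneg u
  have hKu := mul_nonneg hK0 hun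
  have hNpos : 0 < N := by positivity
  obtain ⟨δ, hδ, H⟩ := exists_symmetric_difference_bounds hc h0 hG
    (show 0 < ε / N ^ 2 by positivity)
  have e1 : ∀ᶠ t in 𝓝[>] (0 : ℝ), t < min 1 (δ / N) :=
    nhdsWithin_le_nhds (eventually_lt_nhds (by positivity))
  filter_upwards [e1, eventually_mem_nhdsWithin] with t ht1 ht0
  have ht0 : 0 < t := ht0
  obtain ⟨ht1, htδ⟩ := lt_min_iff.1 ht1
  rw [lt_div_iff₀ hNpos] at htδ
  set ρ := √(a + t ^ 2 * b)
  have hρ0 : 0 ≤ ρ := Real.sqrt_nonneg _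
  have hρK : ρ ≤ K := Real.sqrt_le_sqrt (by gcongr; exact mul_le_of_le_one_left hb (pow_le_one₀ ht0.le ht1.le))
  have hr0 : 0 ≤ t * ρ := by positivity
  have nw : ‖t • w‖ = t * ‖w‖ := by rw [norm_smul, Real.norm_of_nonneg ht0.le]
  have nu : ‖(t * ρ) • u‖ = t * ρ * ‖u‖ := by rw [norm_smul, Real.norm_of_nonneg hr0]
  have hsum : ‖t • w‖ + ‖(t * ρ) • u‖ ≤ t * N := by
    rw [nw, nu, mul_assoc, ← mul_add]
    have : ρ * ‖u‖ ≤ K * ‖u‖ := by gcongr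
    exact mul_le_mul_of_nonneg_left (by rw [hN]; linarith) ht0.le
  have hu' : ‖(t * ρ) • u‖ ≤ t * ρ * N := by
    rw [nu]
    exact mul_le_mul_of_nonneg_left (by rw [hN]; linarith) hr0
  obtain ⟨b1, b2, b3⟩ := H (t • w) ((t * ρ) • u) (hsum.trans_lt htδ)
  refine ⟨b1.trans ?_, b2.trans ?_, b3.trans ?_⟩
  · calc _ ≤ ε / N ^ 2 * (t * N) * (t * ρ * N) := by gcongr
      _ = _ := by field_simp
  · calc _ ≤ ε / N ^ 2 * (t * ρ * N) ^ 2 := by gcongr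
      _ = _ := by field_simp
  · calc _ ≤ ε / N ^ 2 * (t * N) ^ 2 := by gcongr
      _ = _ := by field_simp

/-- If a `C²` function with Taylor polynomial `l v + B v v` vanishes along both curves
`t w ± t √(a + t² b) u`, then the coefficients of the two curves' expansions vanish. -/
lemma taylor_relations_of_vanish_on_curves {F G : E → ℝ} {l : E →ₗ[ℝ] ℝ}
    {B : E →ₗ[ℝ] E →ₗ[ℝ] ℝ} (hF : ∀ v, F v = l v + B v v + G v) (hc : ContDiff ℝ 2 G)
    (h0 : G 0 = 0) (hG : G =o[𝓝 0] fun v => ‖v‖ ^ 2) {u w : E} {a b : ℝ} (ha : 0 ≤ a)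
    (hb : 0 ≤ b) (hab : 0 < a + b)
    (hadd : ∀ t : ℝ, F (t • w + (t * √(a + t ^ 2 * b)) • u) = 0)
    (hsub : ∀ t : ℝ, F (t • w - (t * √(a + t ^ 2 * b)) • u) = 0) :
    (l u = 0 ∧ B w u + B u w = 0) ∧ (l w = 0 ∧ B w w + a * B u u = 0) := by
  have h1 : l u = 0 ∧ B w u + B u w = 0 := by
    refine eq_zero_of_abs_add_mul_le (γ := 0) fun ε hε => ?_
    filter_upwards [eventually_curve_bounds hc h0 hG u w hb hε (a := a), eventually_mem_nhdsWithin]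
      with t ⟨ht, _⟩ ht0
    have ht0 : 0 < t := ht0
    have hρ := sqrt_add_sq_mul_pos ha hb hab ht0
    have e1 := hadd t
    have e2 := hsub t
    rw [hF] at e1 e2
    set ρ := √(a + t ^ 2 * b)
    have hr : 0 < t * ρ := by positivity
    have e3 : G (t • w + (t * ρ) • u) - G (t • w - (t * ρ) • u) =
        -2 * ((t * ρ) * (l u + t * (B w u + B u w) + t ^ 3 * 0)) := by
      simp only [map_add, map_sub, map_smul, LinearMap.add_apply, LinearMap.sub_apply,
        LinearMap.smul_apply, smul_eq_mul] at e1 e2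
      linear_combination e1 - e2
    rw [e3, abs_mul, abs_mul (t * ρ), abs_of_pos hr] at ht
    norm_num at ht
    refine le_of_mul_le_mul_right ?_ hr
    have := mul_nonneg hr.le (abs_nonneg (l u + t * (B w u + B u w)))
    norm_num
    linarith
  refine ⟨h1, ?_⟩
  obtain ⟨hlu, hwu⟩ := h1
  refine eq_zero_of_abs_add_mul_le (γ := b * B u u) fun ε hε => ?_
  filter_upwards [eventually_curve_bounds hc h0 hG u w hb hε (a := a), eventually_mem_nhdsWithin]
    with t ⟨_, _, ht⟩ ht0
  have ht0 : 0 < t := ht0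
  have e1 := hadd t
  rw [hF] at e1
  have hsq : √(a + t ^ 2 * b) ^ 2 = a + t ^ 2 * b := Real.sq_sqrt (by positivity)
  set ρ := √(a + t ^ 2 * b)
  have e3 : G (t • w + (t * ρ) • u) =
      -(t * (l w + t * (B w w + a * B u u) + t ^ 3 * (b * B u u))) := by
    simp only [map_add, map_smul, LinearMap.add_apply, LinearMap.smul_apply, smul_eq_mul] at e1
    linear_combination e1 - t * ρ * hlu - t ^ 2 * ρ * hwu - t ^ 2 * B u u * hsq
  rw [e3, abs_neg, abs_mul, abs_of_pos ht0] at ht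
  refine le_of_mul_le_mul_left ?_ ht0
  linarith

lemma bilinear_eq_of_vanish_on_curves {F G : E → ℝ} {l : E →ₗ[ℝ] ℝ}
    {B : E →ₗ[ℝ] E →ₗ[ℝ] ℝ} (hF : ∀ v, F v = l v + B v v + G v) (hc : ContDiff ℝ 2 G)
    (h0 : G 0 = 0) (hG : G =o[𝓝 0] fun v => ‖v‖ ^ 2) {u u' w : E} {a b : ℝ} (ha : 0 ≤ a)
    (hb : 0 ≤ b) (hab : 0 < a + b)
    (hadd : ∀ t : ℝ, F (t • w + (t * √(a + t ^ 2 * b)) • u) = 0)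
    (hsub : ∀ t : ℝ, F (t • w - (t * √(a + t ^ 2 * b)) • u) = 0)
    (hadd' : ∀ t : ℝ, F (t • w + (t * √(a + t ^ 2 * b)) • u') = 0)
    (hsub' : ∀ t : ℝ, F (t • w - (t * √(a + t ^ 2 * b)) • u') = 0) :
    B u u = B u' u' := by
  have key : ∀ ε > 0, |B u u - B u' u'| ≤ ε := by
    intro ε hε
    obtain ⟨t, ⟨_, ht, _⟩, ⟨_, ht', _⟩, ht0⟩ :=
      ((eventually_curve_bounds hc h0 hG u w hb hε (a := a)).and
        ((eventually_curve_bounds hc h0 hG u' w hb hε (a := a)).and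
          eventually_mem_nhdsWithin)).exists
    have hr := mul_pos ht0 (sqrt_add_sq_mul_pos ha hb hab ht0)
    have e1 := hadd t
    have e2 := hsub t
    have e3 := hadd' t
    have e4 := hsub' t
    rw [hF] at e1 e2 e3 e4
    set r := t * √(a + t ^ 2 * b)
    simp only [map_add, map_sub, map_smul, LinearMap.add_apply, LinearMap.sub_apply,
      LinearMap.smul_apply, smul_eq_mul] at e1 e2 e3 e4
    have hr2 : 0 < r ^ 2 := by positivity
    rw [abs_le] at ht ht' ⊢
    constructor
    · refine le_of_mul_le_mul_left ?_ hr2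
      linarith
    · refine le_of_mul_le_mul_left ?_ hr2
      linarith
  exact sub_eq_zero.1 (abs_nonpos_iff.1 (le_of_forall_pos_le_add fun ε hε => by
    simpa using key ε hε))

end Curve

/-- The second order Taylor polynomial of a `C²` function vanishing on
`Σ_{J₊} xᵢ² = Σ_{J₋} xᵢ² + (Σ_{J₀} xᵢ²)²` is a multiple of `Σ_{J₊} xᵢ² − Σ_{J₋} xᵢ²`. -/
lemma taylor_eq_mul_of_vanish {n : ℕ} {Jp Jm J0 : Finset (Fin n)}
    (hpm : Disjoint Jp Jm) (hp0 : Disjoint Jp J0) (hcover : Jp ∪ Jm ∪ J0 = Finset.univ)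
    (hJp : Jp.Nonempty) (hJm0 : (Jm ∪ J0).Nonempty)
    {F G : (Fin n → ℝ) → ℝ} {l : (Fin n → ℝ) →ₗ[ℝ] ℝ}
    {B : (Fin n → ℝ) →ₗ[ℝ] (Fin n → ℝ) →ₗ[ℝ] ℝ}
    (hF : ∀ v, F v = l v + B v v + G v) (hc : ContDiff ℝ 2 G)
    (h0 : G 0 = 0) (hG : G =o[𝓝 0] fun v => ‖v‖ ^ 2)
    (hvan : ∀ x : Fin n → ℝ,
      (∑ i ∈ Jp, x i ^ 2) - (∑ i ∈ Jm, x i ^ 2) - (∑ i ∈ J0, x i ^ 2) ^ 2 = 0 → F x = 0) :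
    ∃ c : ℝ, ∀ v, l v + B v v = c * ((∑ i ∈ Jp, v i ^ 2) - ∑ i ∈ Jm, v i ^ 2) := by
  have hcurve : ∀ u w : Fin n → ℝ, (∀ i ∉ Jp, u i = 0) → ∑ i ∈ Jp, u i ^ 2 = 1 →
      (∀ i ∈ Jp, w i = 0) → ∀ t : ℝ,
      F (t • w + (t * √(∑ i ∈ Jm, w i ^ 2 + t ^ 2 * (∑ i ∈ J0, w i ^ 2) ^ 2)) • u) = 0 := by
    intro u w hu hu1 hw t
    apply hvan
    have hsq : √(∑ i ∈ Jm, w i ^ 2 + t ^ 2 * (∑ i ∈ J0, w i ^ 2) ^ 2) ^ 2 =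
        ∑ i ∈ Jm, w i ^ 2 + t ^ 2 * (∑ i ∈ J0, w i ^ 2) ^ 2 :=
      Real.sq_sqrt (by positivity)
    set ρ := √(∑ i ∈ Jm, w i ^ 2 + t ^ 2 * (∑ i ∈ J0, w i ^ 2) ^ 2)
    have ep : ∑ i ∈ Jp, (t • w + (t * ρ) • u) i ^ 2 = (t * ρ) ^ 2 * ∑ i ∈ Jp, u i ^ 2 := by
      rw [Finset.mul_sum]
      refine Finset.sum_congr rfl fun i hi => ?_
      simp [hw i hi, mul_pow]
    have eo : ∀ J : Finset (Fin n), Disjoint Jp J →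
        ∑ i ∈ J, (t • w + (t * ρ) • u) i ^ 2 = t ^ 2 * ∑ i ∈ J, w i ^ 2 := by
      intro J hJ
      rw [Finset.mul_sum]
      refine Finset.sum_congr rfl fun i hi => ?_
      simp [hu i (Finset.disjoint_right.1 hJ hi), mul_pow]
    rw [ep, eo Jm hpm, eo J0 hp0, hu1]
    linear_combination t ^ 2 * hsq
  have hcurve' : ∀ u w : Fin n → ℝ, (∀ i ∉ Jp, u i = 0) → ∑ i ∈ Jp, u i ^ 2 = 1 →
      (∀ i ∈ Jp, w i = 0) → ∀ t : ℝ,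
      F (t • w - (t * √(∑ i ∈ Jm, w i ^ 2 + t ^ 2 * (∑ i ∈ J0, w i ^ 2) ^ 2)) • u) = 0 := by
    intro u w hu hu1 hw t
    have := hcurve (-u) w (fun i hi => by simp [hu i hi]) (by simpa using hu1) hw t
    rwa [smul_neg, ← sub_eq_add_neg] at this
  have hpos : ∀ (w : Fin n → ℝ), (∀ i ∈ Jp, w i = 0) → w ≠ 0 →
      0 < ∑ i ∈ Jm, w i ^ 2 + (∑ i ∈ J0, w i ^ 2) ^ 2 := by
    intro w hw hne
    obtain ⟨k, hk⟩ := Function.ne_iff.1 hne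
    have hk2 : 0 < w k ^ 2 := by have : w k ≠ 0 := hk; positivity
    have hle : ∀ J : Finset (Fin n), k ∈ J → 0 < ∑ i ∈ J, w i ^ 2 := fun J hJ =>
      hk2.trans_le (Finset.single_le_sum (f := fun i => w i ^ 2) (fun i _ => sq_nonneg _) hJ)
    have hmem : k ∈ Jp ∪ Jm ∪ J0 := hcover ▸ Finset.mem_univ k
    simp only [Finset.mem_union] at hmem
    rcases hmem with (h | h) | h
    · exact absurd (hw k h) hk
    · have := hle Jm h
      positivity
    · have := hle J0 h
      positivity
  have hrel := fun u w hu hu1 hw hne => taylor_relations_of_vanish_on_curves hF hc h0 hG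
    (Finset.sum_nonneg fun i _ => sq_nonneg _) (sq_nonneg _) (hpos w hw hne)
    (hcurve u w hu hu1 hw) (hcurve' u w hu hu1 hw)
  obtain ⟨j, hj⟩ := hJp
  obtain ⟨k, hk⟩ := hJm0
  have hkp : k ∉ Jp := by
    rcases Finset.mem_union.1 hk with h | h
    · exact Finset.disjoint_right.1 hpm h
    · exact Finset.disjoint_right.1 hp0 h
  set e : Fin n → ℝ := Pi.single j 1
  have he : ∀ i ∉ Jp, e i = 0 := fun i hi =>
    Pi.single_eq_of_ne (fun h : i = j => hi (h ▸ hj)) _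
  have he1 : ∑ i ∈ Jp, e i ^ 2 = 1 := by
    rw [Finset.sum_eq_single_of_mem j hj fun i _ hi => by simp [e, hi]]
    simp [e]
  set d : Fin n → ℝ := Pi.single k 1
  have hd : ∀ i ∈ Jp, d i = 0 := fun i hi =>
    Pi.single_eq_of_ne (fun h : i = k => hkp (h ▸ hi)) _
  have hd0 : d ≠ 0 := by simp [d]
  have hu : ∀ u : Fin n → ℝ, (∀ i ∉ Jp, u i = 0) → ∃ s : ℝ, ∃ u' : Fin n → ℝ, u = s • u' ∧
      (∀ i ∉ Jp, u' i = 0) ∧ ∑ i ∈ Jp, u' i ^ 2 = 1 := by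
    intro u hu
    have hS : 0 ≤ ∑ i ∈ Jp, u i ^ 2 := Finset.sum_nonneg fun i _ => sq_nonneg _
    rcases hS.eq_or_lt with h | h
    · refine ⟨0, e, ?_, he, he1⟩
      ext i
      by_cases hi : i ∈ Jp
      · have := (Finset.sum_eq_zero_iff_of_nonneg fun i _ => sq_nonneg (u i)).1 h.symm i hi
        simpa using this
      · simpa using hu i hi
    · have hs := Real.sqrt_pos.2 h
      refine ⟨√(∑ i ∈ Jp, u i ^ 2), (√(∑ i ∈ Jp, u i ^ 2))⁻¹ • u, ?_, ?_, ?_⟩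
      · rw [smul_smul, mul_inv_cancel₀ hs.ne', one_smul]
      · intro i hi
        simp [hu i hi]
      · simp only [Pi.smul_apply, smul_eq_mul, mul_pow]
        rw [← Finset.mul_sum, inv_pow, Real.sq_sqrt hS, inv_mul_cancel₀ h.ne']
  refine ⟨B e e, fun v => ?_⟩
  set u : Fin n → ℝ := fun i => if i ∈ Jp then v i else 0
  set w : Fin n → ℝ := fun i => if i ∈ Jp then 0 else v i
  have hv : v = u + w := by
    ext i
    by_cases hi : i ∈ Jp <;> simp [u, w, hi]
  have hup : ∀ i ∉ Jp, u i = 0 := fun i hi => by simp [u, hi]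
  have hwp : ∀ i ∈ Jp, w i = 0 := fun i hi => by simp [w, hi]
  have hsp : ∑ i ∈ Jp, v i ^ 2 = ∑ i ∈ Jp, u i ^ 2 :=
    Finset.sum_congr rfl fun i hi => by simp [u, hi]
  have hsm : ∑ i ∈ Jm, v i ^ 2 = ∑ i ∈ Jm, w i ^ 2 :=
    Finset.sum_congr rfl fun i hi => by simp [w, Finset.disjoint_right.1 hpm hi]
  obtain ⟨s, u', hs, hu', hu1⟩ := hu u hup
  have hlu : l u' = 0 := (hrel u' d hu' hu1 hd hd0).1.1
  have hBu : B u' u' = B e e :=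
    bilinear_eq_of_vanish_on_curves hF hc h0 hG
      (Finset.sum_nonneg fun i _ => sq_nonneg _) (sq_nonneg _) (hpos d hd hd0)
      (hcurve u' d hu' hu1 hd) (hcurve' u' d hu' hu1 hd)
      (hcurve e d he he1 hd) (hcurve' e d he he1 hd)
  have hw : B w u' + B u' w = 0 ∧ l w = 0 ∧ B w w + (∑ i ∈ Jm, w i ^ 2) * B e e = 0 := by
    by_cases hw0 : w = 0
    · simp [hw0]
    · have h := hrel u' w hu' hu1 hwp hw0
      rw [hBu] at h
      exact ⟨h.1.2, h.2⟩
  obtain ⟨hwu, hlw, hww⟩ := hw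
  have hus : ∑ i ∈ Jp, u i ^ 2 = s ^ 2 := by
    simp only [hs, Pi.smul_apply, smul_eq_mul, mul_pow]
    rw [← Finset.mul_sum, hu1, mul_one]
  rw [hsp, hsm, hus]
  conv_lhs => rw [hv, hs]
  simp only [map_add, map_smul, LinearMap.add_apply, LinearMap.smul_apply, smul_eq_mul]
  linear_combination s * hlu + hlw + s * hwu + hww + s ^ 2 * hBu

lemma coeff_mul_of_isHomogeneous {σ R : Type*} [CommSemiring R] {p : MvPolynomial σ R} {m : ℕ}
    (hp : p.IsHomogeneous m) (q : MvPolynomial σ R) {d : σ →₀ ℕ} (hd : d.degree ≤ m) :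
    coeff d (q * p) = coeff 0 q * coeff d p := by
  classical
  rw [coeff_mul]
  refine Finset.sum_eq_single_of_mem (0, d) (by simp) fun x hx hne => ?_
  rw [Finset.HasAntidiagonal.mem_antidiagonal] at hx
  rw [hp.coeff_eq_zero, mul_zero]
  intro h
  have hdeg := congrArg Finsupp.degree hx
  rw [map_add] at hdeg
  have h1 : x.1 = 0 := by rw [← Finsupp.degree_eq_zero_iff]; omega
  exact hne (Prod.ext h1 (by simpa [h1] using hx))

/-- For a partition `{1,…,n} = J₊ ∪ J₋ ∪ J₀` with `J₊ ≠ ∅` and `J₋ ∪ J₀ ≠ ∅`, and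
`q = Σ_{J₊} xᵢ² − Σ_{J₋} xᵢ² − (Σ_{J₀} xᵢ²)²`, one has `I²({q = 0}) = ⟨p⟩₂` where
`p = Σ_{J₊} xᵢ² − Σ_{J₋} xᵢ²`. -/
theorem stmt13 (n : ℕ) (hn : 2 ≤ n) (Jp Jm J0 : Finset (Fin n))
    (hpm : Disjoint Jp Jm) (hp0 : Disjoint Jp J0) (hm0 : Disjoint Jm J0)
    (hcover : Jp ∪ Jm ∪ J0 = Finset.univ)
    (hJp : Jp.Nonempty) (hJm0 : (Jm ∪ J0).Nonempty) :
    Im n 2 {x : Fin n → ℝ |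
        (∑ i ∈ Jp, x i ^ 2) - (∑ i ∈ Jm, x i ^ 2) - (∑ i ∈ J0, x i ^ 2) ^ 2 = 0} =
      truncIdeal n 2 (fun _ : Fin 1 =>
        (∑ i ∈ Jp, X i ^ 2) - (∑ i ∈ Jm, (X i : MvPolynomial (Fin n) ℝ) ^ 2)) := by
  set p₀ : MvPolynomial (Fin n) ℝ :=
    (∑ i ∈ Jp, X i ^ 2) - (∑ i ∈ Jm, (X i : MvPolynomial (Fin n) ℝ) ^ 2)
  have hhom : p₀.IsHomogeneous 2 :=
    (IsHomogeneous.sum _ _ _ fun i _ => isHomogeneous_X_pow i 2).sub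
      (IsHomogeneous.sum _ _ _ fun i _ => isHomogeneous_X_pow i 2)
  have heval : ∀ v : Fin n → ℝ,
      eval v p₀ = (∑ i ∈ Jp, v i ^ 2) - ∑ i ∈ Jm, v i ^ 2 := fun v => by simp [p₀]
  ext P
  constructor
  · rintro ⟨hdeg, F, hFc, hvan, ho⟩
    refine ⟨hdeg, ?_⟩
    obtain ⟨c₀, l, B, hP⟩ := exists_eval_eq_add_linear_add_bilinear P hdeg
    have hG0 : F 0 - eval 0 P = 0 := by
      have := (ho.bound one_pos).self_of_nhds
      simpa using this
    have hc₀ : c₀ = 0 := by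
      have h1 : F 0 = 0 := hvan 0 (by simp)
      have h2 := hP 0
      simp only [map_zero, add_zero] at h2
      linarith
    subst hc₀
    have hPc : ContDiff ℝ 2 fun v : Fin n → ℝ => eval v P := by
      simp only [eval_eq]
      fun_prop
    obtain ⟨c, hc⟩ := taylor_eq_mul_of_vanish hpm hp0 hcover hJp hJm0
      (F := F) (G := fun v => F v - eval v P) (l := l) (B := B)
      (fun v => by rw [hP]; ring) (hFc.sub hPc) hG0 ho hvan
    have hPeq : P = C c * p₀ := by
      refine MvPolynomial.funext fun v => ?_
      rw [hP, zero_add, hc, map_mul, eval_C, heval]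
    exact ⟨fun _ => C c, fun d _ => by simp [← hPeq]⟩
  · rintro ⟨hdeg, q, hq⟩
    have hPeq : P = C (coeff 0 (q 0)) * p₀ := by
      ext d
      rw [coeff_C_mul]
      by_cases hd : d.degree ≤ 2
      · have := hq d hd
        rw [Fin.sum_univ_one, coeff_sub, coeff_mul_of_isHomogeneous hhom _ hd] at this
        linarith
      · rw [hhom.coeff_eq_zero (by omega), mul_zero]
        exact coeff_eq_zero_of_totalDegree_lt (by
          change _ < d.degree
          omega)
    set c := coeff 0 (q 0)
    refine ⟨hdeg, fun v => c * ((∑ i ∈ Jp, v i ^ 2) - (∑ i ∈ Jm, v i ^ 2)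
      - (∑ i ∈ J0, v i ^ 2) ^ 2), by fun_prop, fun x hx => ?_, ?_⟩
    · change _ = _ at hx
      simp [hx]
    · have hJ0 : (fun v : Fin n → ℝ => ∑ i ∈ J0, v i ^ 2) =O[𝓝 0] fun v => ‖v‖ ^ 2 := by
        refine IsBigO.fun_sum fun i _ => IsBigO.of_bound 1 (Eventually.of_forall fun v => ?_)
        rw [one_mul, norm_pow, norm_pow, norm_norm]
        exact pow_le_pow_left₀ (norm_nonneg _) (norm_le_pi_norm v i) 2
      have h4 : (fun v : Fin n → ℝ => (‖v‖ ^ 2) ^ 2) =o[𝓝 0] fun v => ‖v‖ ^ 2 := by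
        simp only [← pow_mul]
        exact isLittleO_norm_pow_norm_pow (by norm_num)
      refine (((hJ0.pow 2).trans_isLittleO h4).const_mul_left (-c)).congr_left fun v => ?_
      rw [hPeq, map_mul, eval_C, heval]
      ring
end

section
/- Fix n ≥ 1 and let p be a positive definite quadratic form on ℝⁿ (i.e., p is homogeneous of degree 2 and p(v) > 0 for all v ≠ 0). Then there is no set E ⊆ ℝⁿ containing the origin such that I²(E) = ⟨p⟩₂. -/
open MvPolynomial Filter Asymptotics Topology

theorem MvPolynomial.IsHomogeneous.eval_smul_eq {σ R : Type*} [CommSemiring R]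
    {p : MvPolynomial σ R} {m : ℕ} (hp : p.IsHomogeneous m) (t : R) (v : σ → R) :
    eval (t • v) p = t ^ m * eval v p := by
  rw [eval_eq, eval_eq, Finset.mul_sum]
  refine Finset.sum_congr rfl fun d hd => ?_
  have hdeg : ∑ i ∈ d.support, d i = m := (hp.degree_eq_sum_deg_support hd).symm
  simp only [Pi.smul_apply, smul_eq_mul, mul_pow, Finset.prod_mul_distrib,
    Finset.prod_pow_eq_pow_sum, hdeg]
  ring

/-- A positive definite form of degree `m` is bounded below by a positive multiple of `‖v‖ ^ m`. -/
theorem exists_mul_norm_pow_le_eval {σ : Type*} [Fintype σ] [Nonempty σ] {m : ℕ}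
    {p : MvPolynomial σ ℝ}
    (hhom : p.IsHomogeneous m) (hpos : ∀ v : σ → ℝ, v ≠ 0 → 0 < eval v p) :
    ∃ c : ℝ, 0 < c ∧ ∀ v : σ → ℝ, v ≠ 0 → c * ‖v‖ ^ m ≤ eval v p := by
  obtain ⟨w, hw, hmin⟩ := (isCompact_sphere (0 : σ → ℝ) 1).exists_isMinOn
    (NormedSpace.sphere_nonempty.2 zero_le_one) p.continuous_eval.continuousOn
  refine ⟨eval w p, hpos w (ne_zero_of_mem_unit_sphere ⟨w, hw⟩), fun v hv => ?_⟩
  have hv' : ‖v‖ ≠ 0 := norm_ne_zero_iff.2 hv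
  have hle : eval w p ≤ eval (‖v‖⁻¹ • v) p :=
    hmin (by simp [norm_smul, hv'])
  calc eval w p * ‖v‖ ^ m ≤ eval (‖v‖⁻¹ • v) p * ‖v‖ ^ m := by gcongr
    _ = eval v p := by
      rw [hhom.eval_smul_eq, mul_right_comm, ← mul_pow, inv_mul_cancel₀ hv', one_pow, one_mul]

/-- If a positive definite form lies in `Iᵐ(E)`, then no nonzero points of `E` are near `0`. -/
theorem eventually_notMem_of_mem_Im {n m : ℕ} [Nonempty (Fin n)] {E : Set (Fin n → ℝ)}
    {p : MvPolynomial (Fin n) ℝ} (hhom : p.IsHomogeneous m)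
    (hpos : ∀ v : Fin n → ℝ, v ≠ 0 → 0 < eval v p) (hp : p ∈ Im n m E) :
    ∀ᶠ v in 𝓝 (0 : Fin n → ℝ), v ∈ E → v = 0 := by
  obtain ⟨-, F, -, hFE, hF⟩ := hp
  obtain ⟨c, hc, hle⟩ := exists_mul_norm_pow_le_eval hhom hpos
  filter_upwards [hF.def (half_pos hc)] with v hv hvE
  by_contra hv0
  have hlt : 0 < c * ‖v‖ ^ m := mul_pos hc (pow_pos (norm_pos_iff.2 hv0) m)
  rw [hFE v hvE, zero_sub, norm_neg, Real.norm_of_nonneg (hpos v hv0).le,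
    Real.norm_of_nonneg (by positivity)] at hv
  linarith [hle v hv0]

/-- If `0` is isolated in `E`, every polynomial of degree at most `m` vanishing at `0` lies in
`Iᵐ(E)`. -/
theorem mem_Im_of_eventually_notMem {n m : ℕ} {E : Set (Fin n → ℝ)}
    (hE : ∀ᶠ v in 𝓝 (0 : Fin n → ℝ), v ∈ E → v = 0) {q : MvPolynomial (Fin n) ℝ}
    (hdeg : q.totalDegree ≤ m) (hq : eval 0 q = 0) : q ∈ Im n m E := by
  obtain ⟨ε, hε, hball⟩ := Metric.eventually_nhds_iff_ball.1 hE
  let f : ContDiffBump (0 : Fin n → ℝ) := ⟨ε / 2, ε, half_pos hε, half_lt_self hε⟩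
  refine ⟨hdeg, fun v => f v * eval v q, f.contDiff.mul ?_, fun v hv => ?_, ?_⟩
  · simp only [eval_eq]
    fun_prop
  · beta_reduce
    by_cases hvε : v ∈ Metric.ball 0 ε
    · rw [hball v hvε hv, hq, mul_zero]
    · rw [f.zero_of_le_dist (not_lt.1 hvε), zero_mul]
  · refine (isLittleO_zero _ _).congr' ?_ EventuallyEq.rfl
    filter_upwards [f.eventuallyEq_one] with v hv
    simp [hv]

/-- The truncated ideal of forms of degree at least two contains no variable. -/
theorem X_notMem_truncIdeal {n m k : ℕ} {ι : Type} [Fintype ι]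
    {ps : ι → MvPolynomial (Fin n) ℝ} (hm : 1 ≤ m) (hk : 2 ≤ k)
    (hps : ∀ j, (ps j).IsHomogeneous k) (i : Fin n) : X i ∉ truncIdeal n m ps := by
  rintro ⟨-, q, hq⟩
  have h := hq (Finsupp.single i 1) (by simpa using hm)
  have hzero : coeff (Finsupp.single i 1) (∑ j, q j * ps j) = 0 := by
    rw [coeff_sum]
    refine Finset.sum_eq_zero fun j _ => ?_
    rw [coeff_mul]
    refine Finset.sum_eq_zero fun x hx => ?_
    have hd := congrArg Finsupp.degree (Finset.HasAntidiagonal.mem_antidiagonal.1 hx)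
    rw [map_add, Finsupp.degree_single] at hd
    rw [(hps j).coeff_eq_zero (by omega), mul_zero]
  rw [coeff_sub, hzero] at h
  simp at h

/-- If `p` is a positive definite quadratic form on `ℝⁿ`, then no set `E` containing the
origin satisfies `I²(E) = ⟨p⟩₂`. -/
theorem stmt14 (n : ℕ) (hn : 1 ≤ n) (p : MvPolynomial (Fin n) ℝ)
    (hhom : p.IsHomogeneous 2) (hpos : ∀ v : Fin n → ℝ, v ≠ 0 → 0 < eval v p) :
    ¬ ∃ E : Set (Fin n → ℝ), (0 : Fin n → ℝ) ∈ E ∧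
        Im n 2 E = truncIdeal n 2 (fun _ : Fin 1 => p) := by
  rintro ⟨E, -, hE⟩
  have : Nonempty (Fin n) := ⟨⟨0, hn⟩⟩
  have hp : p ∈ Im n 2 E := hE ▸ ⟨hhom.totalDegree_le, 1, fun d _ => by simp⟩
  let i : Fin n := ⟨0, hn⟩
  have hX : X i ∈ Im n 2 E :=
    mem_Im_of_eventually_notMem (eventually_notMem_of_mem_Im hhom hpos hp)
      (by simp) (by simp)
  rw [hE] at hX
  exact X_notMem_truncIdeal one_le_two le_rfl (fun _ => hhom) i hX
end

section
/- Fix n ≥ 2 and pairwise disjoint subsets J¹₊, J¹₋, J²₊, J²₋ of {1,…,n}, and let J₀ = {1,…,n} ∖ (J¹₊ ∪ J¹₋ ∪ J²₊ ∪ J²₋). Assume J¹₊ ≠ ∅, J²₊ ≠ ∅, and J¹₋ ∪ J²₋ ∪ J₀ ≠ ∅. For α ∈ {1,2} let p_α(x) = Σ_{i∈J^α₊} x_i² − Σ_{i∈J^α₋} x_i² and q_α(x) = p_α(x) − (Σ_{i∉J^α₊∪J^α₋} x_i²)². Then I²({x ∈ ℝⁿ : q₁(x) = q₂(x) = 0})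 = ⟨p₁, p₂⟩₂. -/
open MvPolynomial Filter Asymptotics Topology

theorem exists_pos_balanced {b₁ b₂ c : ℝ} (h₁ : 0 ≤ b₁) (h₂ : 0 ≤ b₂) (hc : 0 ≤ c)
    (hpos : 0 < b₁ + b₂ + c) (hle : b₁ + b₂ + c ≤ 1 / 100) :
    ∃ a₁ a₂ : ℝ, 0 < a₁ ∧ 0 < a₂ ∧ a₁ ≤ 2 * (b₁ + b₂ + c) ∧ a₂ ≤ 2 * (b₁ + b₂ + c) ∧
      a₁ = b₁ + (a₂ + b₂ + c) ^ 2 ∧ a₂ = b₂ + (a₁ + b₁ + c) ^ 2 := by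
  set τ := b₁ + b₂ + c with hτ
  let f : ℝ → ℝ := fun a => a - b₁ - ((b₂ + (a + b₁ + c) ^ 2) + b₂ + c) ^ 2
  have key : ∀ a, 0 ≤ a → a ≤ 2 * τ →
      b₂ + (a + b₁ + c) ^ 2 ≤ 2 * τ ∧ ((b₂ + (a + b₁ + c) ^ 2) + b₂ + c) ^ 2 ≤ τ := by
    intro a ha ha'
    have e1 : (a + b₁ + c) ^ 2 ≤ τ := by nlinarith
    refine ⟨by linarith, ?_⟩
    have e3 : b₂ + (a + b₁ + c) ^ 2 + b₂ + c ≤ 3 * τ := by linarith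
    nlinarith [sq_nonneg (a + b₁ + c)]
  obtain ⟨a, ⟨ha, ha'⟩, hfa⟩ : (0 : ℝ) ∈ f '' Set.Icc 0 (2 * τ) := by
    refine intermediate_value_Icc (by linarith) (by fun_prop) ⟨?_, ?_⟩
    · simp only [f]; nlinarith [sq_nonneg (b₂ + (0 + b₁ + c) ^ 2 + b₂ + c)]
    · have := (key (2 * τ) (by linarith) le_rfl).2
      simp only [f]; linarith
  simp only [f] at hfa
  have q1 := sq_nonneg (a + b₁ + c)
  have q2 := sq_nonneg ((b₂ + (a + b₁ + c) ^ 2) + b₂ + c)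
  have hpos' : 0 < a + b₁ + c := by
    by_contra! hcon
    have h1 : a = 0 := by linarith
    have h2 : b₁ = 0 := by linarith
    have h3 : c = 0 := by linarith
    simp only [h1, h2, h3] at hfa
    have : 0 < b₂ := by linarith
    nlinarith
  have q3 : 0 < (a + b₁ + c) ^ 2 := by positivity
  have q4 : 0 < ((b₂ + (a + b₁ + c) ^ 2) + b₂ + c) ^ 2 := by positivity
  exact ⟨a, b₂ + (a + b₁ + c) ^ 2, by linarith, by linarith, ha', (key a ha ha').1,
    by linarith, rfl⟩

theorem ContDiff.exists_norm_mixed_difference_le {V : Type*} [NormedAddCommGroup V]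
    [NormedSpace ℝ V] {G : V → ℝ} (hG : ContDiff ℝ 2 G)
    (h2 : fderiv ℝ (fderiv ℝ G) 0 = 0) {ε : ℝ} (hε : 0 < ε) :
    ∃ δ > 0, ∀ x a b : V, ‖x‖ < δ → ‖x + a‖ < δ → ‖x + b‖ < δ → ‖x + a + b‖ < δ →
      |G (x + a + b) - G (x + a) - G (x + b) + G x| ≤ ε * ‖a‖ * ‖b‖ := by
  have hG' : ContDiff ℝ 1 (fderiv ℝ G) := hG.fderiv_right (by norm_num)
  have hs : HasStrictFDerivAt (fderiv ℝ G) (0 : V →L[ℝ] V →L[ℝ] ℝ) 0 := by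
    rw [← h2]
    exact hG'.contDiffAt.hasStrictFDerivAt (by norm_num)
  obtain ⟨s, hs, hL⟩ := hs.exists_lipschitzOnWith_of_nnnorm_lt ⟨ε, hε.le⟩
    (by rw [nnnorm_zero]; exact hε)
  obtain ⟨δ, hδ, hball⟩ := Metric.mem_nhds_iff.1 hs
  refine ⟨δ, hδ, fun x a b hx hxa hxb hxab => ?_⟩
  have hd : Differentiable ℝ G := hG.differentiable (by norm_num)
  have hconv : Convex ℝ (Metric.ball (0 : V) δ ∩ (fun y => y + b) ⁻¹' Metric.ball (0 : V) δ) :=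
    (convex_ball 0 δ).inter ((convex_ball 0 δ).translate_preimage_left b)
  have key := hconv.norm_image_sub_le_of_norm_hasFDerivWithin_le (𝕜 := ℝ)
    (f := fun y => G (y + b) - G y) (f' := fun y => fderiv ℝ G (y + b) - fderiv ℝ G y)
    (C := ε * ‖b‖) (x := x) (y := x + a) ?_ ?_ ?_ ?_
  · rw [Real.norm_eq_abs] at key
    calc _ = |G (x + a + b) - G (x + a) - (G (x + b) - G x)| := by congr 1; ring
      _ ≤ _ := key
      _ = _ := by rw [add_sub_cancel_left]; ring
  · intro y _
    exact (((hasFDerivAt_comp_add_right b).2 (hd (y + b)).hasFDerivAt).sub (hd y).hasFDerivAt).hasFDerivWithinAt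
  · rintro y ⟨hy, hy'⟩
    have := hL.norm_sub_le (hball hy') (hball hy)
    rwa [add_sub_cancel_left] at this
  · exact ⟨by simpa using hx, by simpa only [Set.mem_preimage, mem_ball_zero_iff] using hxb⟩
  · exact ⟨by simpa using hxa, by simpa only [Set.mem_preimage, mem_ball_zero_iff] using hxab⟩

theorem fderiv_fderiv_eq_zero_of_isLittleO {V : Type*} [NormedAddCommGroup V]
    [NormedSpace ℝ V] {G : V → ℝ} (hG : ContDiff ℝ 2 G)
    (ho : G =o[𝓝 0] fun v => ‖v‖ ^ 2) :
    G 0 = 0 ∧ fderiv ℝ G 0 = 0 ∧ fderiv ℝ (fderiv ℝ G) 0 = 0 := by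
  have h0 : G 0 = 0 := by
    have := ho.isBigO.eq_zero_imp.self_of_nhds
    exact this (by simp)
  have h1 : HasFDerivAt G (0 : V →L[ℝ] ℝ) 0 := by
    have : G =O[𝓝 0] fun v => ‖v - 0‖ ^ 2 := by simpa using ho.isBigO
    exact this.hasFDerivAt (by norm_num)
  have hG' : ContDiff ℝ 1 (fderiv ℝ G) := hG.fderiv_right (by norm_num)
  refine ⟨h0, h1.fderiv, ?_⟩
  have hd : Differentiable ℝ G := hG.differentiable (by norm_num)
  have hdiag : ∀ w, fderiv ℝ (fderiv ℝ G) 0 w w = 0 := by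
    intro w
    have := convex_univ.taylor_approx_two_segment (s := (Set.univ : Set V)) (f := G)
      (f' := fderiv ℝ G) (f'' := fderiv ℝ (fderiv ℝ G) 0) (x := 0)
      (fun x _ => (hd x).hasFDerivAt) (Set.mem_univ _)
      ((hG'.differentiable (by norm_num)) 0).hasFDerivAt.hasFDerivWithinAt
      (v := 0) (w := w) (by simp) (by simp)
    have hh : Tendsto (fun h : ℝ => h • w) (𝓝[>] 0) (𝓝 0) := by
      have : Continuous fun h : ℝ => h • w := by fun_prop
      simpa using (this.tendsto 0).mono_left nhdsWithin_le_nhds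
    have ho' : (fun h : ℝ => G (h • w)) =o[𝓝[>] 0] fun h : ℝ => h ^ 2 := by
      refine (ho.comp_tendsto hh).trans_isBigO (IsBigO.of_bound (‖w‖ ^ 2) (Eventually.of_forall ?_))
      intro h
      simp [norm_smul, mul_pow, mul_comm]
    have hc := ho'.sub this
    simp only [smul_zero, add_zero, zero_add, h0, h1.fderiv, sub_zero, map_zero, zero_apply,
      sub_sub_cancel] at hc
    have hc' := hc.tendsto_div_nhds_zero
    have hc'' : Tendsto (fun _ : ℝ => fderiv ℝ (fderiv ℝ G) 0 w w / 2) (𝓝[>] 0) (𝓝 0) := by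
      refine hc'.congr' ?_
      filter_upwards [self_mem_nhdsWithin] with h hh
      have : h ≠ 0 := (ne_of_gt hh)
      simp only [smul_eq_mul]
      field_simp
    have := tendsto_nhds_unique hc'' tendsto_const_nhds
    linarith
  have hsymm := hG.contDiffAt.isSymmSndFDerivAt (x := (0 : V)) (by simp)
  ext v w
  have h1 := hdiag (v + w)
  have h2 := hsymm.eq v w
  simp only [map_add, add_apply, hdiag, zero_add, add_zero] at h1
  simp; linarith

theorem ContDiff.exists_norm_difference_le {V : Type*} [NormedAddCommGroup V]
    [NormedSpace ℝ V] {G : V → ℝ} (hG : ContDiff ℝ 2 G)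
    (h1 : fderiv ℝ G 0 = 0) {ε : ℝ} (hε : 0 < ε) :
    ∃ δ > 0, ∀ x a : V, ‖x‖ < δ → ‖x + a‖ < δ → |G (x + a) - G x| ≤ ε * ‖a‖ := by
  have hs : HasStrictFDerivAt G (0 : V →L[ℝ] ℝ) 0 := by
    rw [← h1]
    exact hG.contDiffAt.hasStrictFDerivAt (by norm_num)
  obtain ⟨s, hs, hL⟩ := hs.exists_lipschitzOnWith_of_nnnorm_lt ⟨ε, hε.le⟩
    (by rw [nnnorm_zero]; exact hε)
  obtain ⟨δ, hδ, hball⟩ := Metric.mem_nhds_iff.1 hs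
  refine ⟨δ, hδ, fun x a hx hxa => ?_⟩
  have := hL.norm_sub_le (hball (mem_ball_zero_iff.2 hxa)) (hball (mem_ball_zero_iff.2 hx))
  rwa [add_sub_cancel_left] at this

theorem exists_eq_sum_of_totalDegree_le_two {n : ℕ} {p : MvPolynomial (Fin n) ℝ}
    (hp : p.totalDegree ≤ 2) :
    ∃ (c : ℝ) (L : Fin n → ℝ) (Q : Fin n → Fin n → ℝ), (∀ i j, Q i j = Q j i) ∧
      p = C c + ∑ i, C (L i) * X i + ∑ i, ∑ j, C (Q i j) * (X i * X j) := by
  suffices h : ∀ s : Finset (Fin n →₀ ℕ), (∀ d ∈ s, (d.sum fun _ e => e) ≤ 2) →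
      ∃ (c : ℝ) (L : Fin n → ℝ) (Q : Fin n → Fin n → ℝ), (∀ i j, Q i j = Q j i) ∧
      ∑ d ∈ s, monomial d (coeff d p) =
        C c + ∑ i, C (L i) * X i + ∑ i, ∑ j, C (Q i j) * (X i * X j) by
    obtain ⟨c, L, Q, hQ, h⟩ := h p.support fun d hd => (le_totalDegree hd).trans hp
    exact ⟨c, L, Q, hQ, by rw [← h]; exact p.as_sum⟩
  intro s
  induction s using Finset.induction_on with
  | empty => exact fun _ => ⟨0, 0, 0, by simp, by simp⟩
  | insert d s hd ih =>
    intro hs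
    obtain ⟨c, L, Q, hQ, h⟩ := ih fun d hd => hs d (Finset.mem_insert_of_mem hd)
    rw [Finset.sum_insert hd, h]
    have hdeg := hs d (Finset.mem_insert_self _ _)
    generalize coeff d p = r
    have hcard : (Finsupp.toMultiset d).card = d.sum fun _ e => e := Finsupp.card_toMultiset d
    obtain ⟨m, hm⟩ : ∃ m, m = Finsupp.toMultiset d := ⟨_, rfl⟩
    have hdm : d = Multiset.toFinsupp m := by simp [hm]
    have hc2 : m.card ≤ 2 := by rw [hm, hcard]; exact hdeg
    interval_cases hmc : m.card
    · have hm0 := Multiset.card_eq_zero.1 hmc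
      refine ⟨r + c, L, Q, hQ, ?_⟩
      have : monomial d r = C r := by rw [hdm, hm0]; simp
      rw [this, C_add]; ring
    · obtain ⟨i, hi⟩ := Multiset.card_eq_one.1 hmc
      refine ⟨c, L + Pi.single i r, Q, hQ, ?_⟩
      have : monomial d r = C r * X i := by
        rw [hdm, hi, C_mul_X_eq_monomial]; simp
      rw [this]
      simp only [Pi.add_apply, C_add, add_mul, Finset.sum_add_distrib, Pi.single_apply, apply_ite C,
        C_0, ite_mul, zero_mul, Finset.sum_ite_eq', Finset.mem_univ, if_true]
      ring
    · obtain ⟨i, j, hij⟩ := Multiset.card_eq_two.1 hmc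
      refine ⟨c, L, fun k l => Q k l + (if k = i then if l = j then r / 2 else 0 else 0) +
        (if k = j then if l = i then r / 2 else 0 else 0), ?_, ?_⟩
      · intro k l
        simp only [hQ k l]
        split_ifs <;> ring
      have : monomial d r = C (r / 2) * (X i * X j) + C (r / 2) * (X j * X i) := by
        have h1 : C (r / 2) * (X i * X j) + C (r / 2) * (X j * X i) =
            (C (r / 2 + r / 2) * X i * X j : MvPolynomial (Fin n) ℝ) := by
          rw [C_add]; ring
        rw [h1, add_halves, hdm, hij, C_mul_X_eq_monomial, X, monomial_mul]
        congr 1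
        · rw [Multiset.insert_eq_cons, ← Multiset.singleton_add, map_add,
            Multiset.toFinsupp_singleton, Multiset.toFinsupp_singleton]
        · simp
      rw [this]
      simp only [C_add, add_mul, Finset.sum_add_distrib, apply_ite C,
        C_0, ite_mul, zero_mul, Finset.sum_ite_irrel, Finset.sum_const_zero,
        Finset.sum_ite_eq', Finset.mem_univ, if_true]
      ring

theorem isLittleO_eval_of_coeff_eq_zero {n m : ℕ} {r : MvPolynomial (Fin n) ℝ}
    (hr : ∀ d : Fin n →₀ ℕ, (d.sum fun _ e => e) ≤ m → coeff d r = 0) :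
    (fun v => eval v r) =o[𝓝 (0 : Fin n → ℝ)] fun v => ‖v‖ ^ m := by
  simp only [eval_eq]
  refine IsLittleO.fun_sum fun d hd => IsLittleO.const_mul_left ?_ _
  have hdeg : m < d.sum fun _ e => e := by
    by_contra! h
    exact mem_support_iff.1 hd (hr d h)
  refine IsBigO.trans_isLittleO (IsBigO.of_bound 1 (Eventually.of_forall fun v => ?_))
    (isLittleO_norm_pow_norm_pow hdeg)
  rw [norm_prod, one_mul, norm_pow, norm_norm, Finsupp.sum, ← Finset.prod_pow_eq_pow_sum]
  refine Finset.prod_le_prod (fun _ _ => norm_nonneg _) fun i _ => ?_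
  rw [norm_pow]
  gcongr
  exact norm_le_pi_norm v i

theorem isBigO_sum_sq {n : ℕ} (s : Finset (Fin n)) :
    (fun v : Fin n → ℝ => ∑ i ∈ s, v i ^ 2) =O[𝓝 0] fun v => ‖v‖ ^ 2 := by
  refine IsBigO.fun_sum fun i _ => IsBigO.of_bound 1 (Eventually.of_forall fun v => ?_)
  rw [one_mul, norm_pow, norm_pow, norm_norm]
  gcongr
  exact norm_le_pi_norm v i

theorem eq_zero_of_forall_abs_le_mul {q K : ℝ} (h : ∀ ε > 0, |q| ≤ K * ε) : q = 0 := by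
  by_contra hq
  have hq' : 0 < |q| := abs_pos.2 hq
  have hK : 0 < |K| + 1 := by positivity
  have h1 := h (|q| / (2 * (|K| + 1))) (by positivity)
  have h2 : K * (|q| / (2 * (|K| + 1))) ≤ (|K| + 1) * (|q| / (2 * (|K| + 1))) := by
    gcongr
    linarith [le_abs_self K]
  have h3 : (|K| + 1) * (|q| / (2 * (|K| + 1))) = |q| / 2 := by field_simp
  linarith

/-- `E` contains, arbitrarily close to the origin, all points whose coordinates off `P₁ ∪ P₂` are
`± t * y` and whose `P₁`- and `P₂`-parts have norms `r₁` and `r₂`, where `rᵢ ^ 2` is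
`t ^ 2 * ∑ k ∈ Mᵢ, y k ^ 2` up to `o(t ^ 2)`. -/
def HasSmallPoints {n : ℕ} (E : Set (Fin n → ℝ)) (P₁ P₂ M₁ M₂ : Finset (Fin n)) : Prop :=
  ∀ y : Fin n → ℝ, (∃ k, k ∉ P₁ ∧ k ∉ P₂ ∧ y k ≠ 0) → ∀ ε > 0, ∃ t r₁ r₂ : ℝ,
    (0 < t ∧ t < ε) ∧ (0 < r₁ ∧ r₁ < ε) ∧ (0 < r₂ ∧ r₂ < ε) ∧
    |r₁ ^ 2 - t ^ 2 * ∑ k ∈ M₁, y k ^ 2| ≤ ε * t ^ 2 ∧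
    |r₂ ^ 2 - t ^ 2 * ∑ k ∈ M₂, y k ^ 2| ≤ ε * t ^ 2 ∧
    ∀ x : Fin n → ℝ, ∑ k ∈ P₁, x k ^ 2 = r₁ ^ 2 → ∑ k ∈ P₂, x k ^ 2 = r₂ ^ 2 →
      (∀ k, k ∉ P₁ → k ∉ P₂ → x k ^ 2 = (t * y k) ^ 2) → x ∈ E

namespace HasSmallPoints

variable {n : ℕ} {E : Set (Fin n → ℝ)} {P₁ P₂ M₁ M₂ : Finset (Fin n)}

theorem symm (h : HasSmallPoints E P₁ P₂ M₁ M₂) : HasSmallPoints E P₂ P₁ M₂ M₁ := by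
  intro y ⟨k, hk₁, hk₂, hk⟩ ε hε
  obtain ⟨t, r₁, r₂, ht, hr₁, hr₂, h₁, h₂, hx⟩ := h y ⟨k, hk₂, hk₁, hk⟩ ε hε
  exact ⟨t, r₂, r₁, ht, hr₂, hr₁, h₂, h₁, fun x e₁ e₂ e => hx x e₂ e₁ fun k a b => e k b a⟩

theorem exists_ne_zero (h : HasSmallPoints E P₁ P₂ M₁ M₂) (hP : Disjoint P₁ P₂)
    (h₁ : P₁.Nonempty) (h₂ : P₂.Nonempty) (hN : ∃ k, k ∉ P₁ ∧ k ∉ P₂) {ε : ℝ} (hε : 0 < ε) :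
    ∃ z : Fin n → ℝ, (∀ k, z k ≠ 0) ∧
      ∀ x : Fin n → ℝ, (∀ k, x k ^ 2 = z k ^ 2) → x ∈ E ∧ ‖x‖ < ε := by
  obtain ⟨k, hk₁, hk₂⟩ := hN
  obtain ⟨t, r₁, r₂, ⟨ht, ht'⟩, ⟨hr₁, hr₁'⟩, ⟨hr₂, hr₂'⟩, -, -, hx⟩ :=
    h (fun _ => 1) ⟨k, hk₁, hk₂, one_ne_zero⟩ ε hε
  have c₁ : 1 ≤ √(P₁.card : ℝ) := Real.one_le_sqrt.2 (by exact_mod_cast h₁.card_pos)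
  have c₂ : 1 ≤ √(P₂.card : ℝ) := Real.one_le_sqrt.2 (by exact_mod_cast h₂.card_pos)
  have d₁ : √(P₁.card : ℝ) ^ 2 = P₁.card := Real.sq_sqrt (by positivity)
  have d₂ : √(P₂.card : ℝ) ^ 2 = P₂.card := Real.sq_sqrt (by positivity)
  let z : Fin n → ℝ := fun k =>
    if k ∈ P₁ then r₁ / √P₁.card else if k ∈ P₂ then r₂ / √P₂.card else t
  have hz : ∀ k, 0 < z k ∧ z k < ε := by
    intro k
    simp only [z]
    split_ifs
    · exact ⟨by positivity, (div_le_self hr₁.le c₁).trans_lt hr₁'⟩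
    · exact ⟨by positivity, (div_le_self hr₂.le c₂).trans_lt hr₂'⟩
    · exact ⟨ht, ht'⟩
  refine ⟨z, fun k => (hz k).1.ne', fun x hxz => ⟨hx x ?_ ?_ ?_, ?_⟩⟩
  · rw [Finset.sum_congr rfl (g := fun _ => (r₁ / √P₁.card) ^ 2)]
    · rw [Finset.sum_const, nsmul_eq_mul, div_pow, d₁]
      have : (P₁.card : ℝ) ≠ 0 := by exact_mod_cast h₁.card_pos.ne'
      field_simp
    · intro k hk
      rw [hxz]
      simp [z, hk]
  · rw [Finset.sum_congr rfl (g := fun _ => (r₂ / √P₂.card) ^ 2)]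
    · rw [Finset.sum_const, nsmul_eq_mul, div_pow, d₂]
      have : (P₂.card : ℝ) ≠ 0 := by exact_mod_cast h₂.card_pos.ne'
      field_simp
    · intro k hk
      rw [hxz]
      simp [z, hk, Finset.disjoint_right.1 hP hk]
  · intro k hk hk'
    rw [hxz]
    simp [z, hk, hk']
  · rw [pi_norm_lt_iff hε]
    intro k
    rw [Real.norm_eq_abs, (sq_eq_sq_iff_abs_eq_abs _ _).1 (hxz k), abs_of_pos (hz k).1]
    exact (hz k).2

theorem exists_sphere (h : HasSmallPoints E P₁ P₂ M₁ M₂) (hP : Disjoint P₁ P₂)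
    (h₂ : P₂.Nonempty) (hN : ∃ k, k ∉ P₁ ∧ k ∉ P₂) {ε : ℝ} (hε : 0 < ε) :
    ∃ (r : ℝ) (w : Fin n → ℝ), 0 < r ∧
      ∀ i ∈ P₁, ∀ s, s ^ 2 = r ^ 2 → w + Pi.single i s ∈ E ∧ ‖w + Pi.single i s‖ < ε := by
  obtain ⟨k, hk₁, hk₂⟩ := hN
  obtain ⟨l, hl⟩ := h₂
  obtain ⟨t, r₁, r₂, ⟨ht, ht'⟩, ⟨hr₁, hr₁'⟩, ⟨hr₂, hr₂'⟩, -, -, hx⟩ :=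
    h (fun _ => 1) ⟨k, hk₁, hk₂, one_ne_zero⟩ ε hε
  let w : Fin n → ℝ := fun k =>
    if k ∈ P₁ then 0 else if k ∈ P₂ then if k = l then r₂ else 0 else t
  refine ⟨r₁, w, hr₁, fun i hi s hs => ?_⟩
  have e₁ : ∀ k ∈ P₁, (w + Pi.single i s : Fin n → ℝ) k = if k = i then s else 0 := by
    intro k hk
    simp [w, hk, Pi.single_apply]
  have e₂ : ∀ k ∈ P₂, (w + Pi.single i s : Fin n → ℝ) k = if k = l then r₂ else 0 := by
    intro k hk
    have hk' := Finset.disjoint_right.1 hP hk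
    have : k ≠ i := fun e => hk' (e ▸ hi)
    simp [w, hk, hk', this]
  have e₃ : ∀ k, k ∉ P₁ → k ∉ P₂ → (w + Pi.single i s : Fin n → ℝ) k = t := by
    intro k hk hk'
    have : k ≠ i := fun e => hk (e ▸ hi)
    simp [w, hk, hk', this]
  refine ⟨hx _ ?_ ?_ ?_, ?_⟩
  · rw [Finset.sum_congr rfl fun k hk => by rw [e₁ k hk]]
    simp [hi, hs]
  · rw [Finset.sum_congr rfl fun k hk => by rw [e₂ k hk]]
    simp [hl]
  · intro k hk hk'
    rw [e₃ k hk hk', mul_one]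
  · have hs' : |s| = r₁ := by rw [(sq_eq_sq_iff_abs_eq_abs _ _).1 hs, abs_of_pos hr₁]
    rw [pi_norm_lt_iff hε]
    intro k
    by_cases hk : k ∈ P₁
    · rw [e₁ k hk]
      split_ifs <;> simp [hs', hr₁', hε]
    by_cases hk' : k ∈ P₂
    · rw [e₂ k hk']
      split_ifs <;> simp [abs_of_pos, hr₂, hr₂', hε]
    · rw [e₃ k hk hk', Real.norm_eq_abs, abs_of_pos ht]
      exact ht'

theorem exists_axis (h : HasSmallPoints E P₁ P₂ M₁ M₂) (hP : Disjoint P₁ P₂)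
    {i l m : Fin n} (hi : i ∈ P₁) (hl : l ∈ P₂) (hm : m ∉ P₁) (hm' : m ∉ P₂)
    {ε : ℝ} (hε : 0 < ε) :
    ∃ t r₁ r₂ : ℝ, 0 < t ∧
      |r₁ ^ 2 - t ^ 2 * (if m ∈ M₁ then 1 else 0)| ≤ ε * t ^ 2 ∧
      |r₂ ^ 2 - t ^ 2 * (if m ∈ M₂ then 1 else 0)| ≤ ε * t ^ 2 ∧
      ∃ x ∈ E, ‖x‖ < ε ∧ ‖x‖ ^ 2 ≤ r₁ ^ 2 + r₂ ^ 2 + t ^ 2 ∧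
        ∀ q : Fin n → ℝ, ∑ k, q k * x k ^ 2 = q i * r₁ ^ 2 + q l * r₂ ^ 2 + q m * t ^ 2 := by
  obtain ⟨t, r₁, r₂, ⟨ht, ht'⟩, ⟨hr₁, hr₁'⟩, ⟨hr₂, hr₂'⟩, b₁, b₂, hx⟩ :=
    h (Pi.single m 1) ⟨m, hm, hm', by simp⟩ ε hε
  have hil : i ≠ l := fun e => Finset.disjoint_left.1 hP hi (e ▸ hl)
  have him : i ≠ m := fun e => hm (e ▸ hi)
  have hlm : l ≠ m := fun e => hm' (e ▸ hl)
  let x : Fin n → ℝ := fun k => if k = i then r₁ else if k = l then r₂ else if k = m then t else 0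
  have hsq : ∀ k, x k ^ 2 = (if k = i then r₁ ^ 2 else 0) + (if k = l then r₂ ^ 2 else 0) +
      (if k = m then t ^ 2 else 0) := by
    intro k
    simp only [x]
    split_ifs <;> simp_all
  refine ⟨t, r₁, r₂, ht, ?_, ?_, x, hx x ?_ ?_ ?_, ?_, ?_, ?_⟩
  · simpa [Pi.single_apply] using b₁
  · simpa [Pi.single_apply] using b₂
  · simp [hsq, Finset.sum_add_distrib, hi, hm, Finset.disjoint_right.1 hP hl]
  · simp [hsq, Finset.sum_add_distrib, hl, hm', Finset.disjoint_left.1 hP hi]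
  · intro k hk hk'
    have h1 : k ≠ i := fun e => hk (e ▸ hi)
    have h2 : k ≠ l := fun e => hk' (e ▸ hl)
    by_cases h3 : k = m <;> simp [x, h1, h2, h3, him.symm, hlm.symm]
  · rw [pi_norm_lt_iff hε]
    intro k
    simp only [x]
    split_ifs <;> simp [abs_of_pos, *]
  · have hs : 0 ≤ r₁ ^ 2 + r₂ ^ 2 + t ^ 2 := by positivity
    rw [← Real.le_sqrt (norm_nonneg _) hs, pi_norm_le_iff_of_nonneg (Real.sqrt_nonneg _)]
    intro k
    rw [Real.le_sqrt (norm_nonneg _) hs, Real.norm_eq_abs, sq_abs, hsq]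
    gcongr <;> split_ifs <;> first | exact le_rfl | positivity
  · intro q
    simp [hsq, mul_add, Finset.sum_add_distrib]

end HasSmallPoints

theorem HasSmallPoints.exists_diagonal_of_mem_Im {n : ℕ} {E : Set (Fin n → ℝ)}
    {P₁ P₂ M₁ M₂ : Finset (Fin n)} (h : HasSmallPoints E P₁ P₂ M₁ M₂) (h0 : (0 : Fin n → ℝ) ∈ E)
    (hP : Disjoint P₁ P₂) (h₁ : P₁.Nonempty) (h₂ : P₂.Nonempty) (hN : ∃ k, k ∉ P₁ ∧ k ∉ P₂)
    {p : MvPolynomial (Fin n) ℝ} (hp : p ∈ Im n 2 E) :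
    ∃ q : Fin n → ℝ, p = ∑ i, C (q i) * X i ^ 2 ∧
      (∀ i ∈ P₁, ∀ j ∈ P₁, q i = q j) ∧ (∀ i ∈ P₂, ∀ j ∈ P₂, q i = q j) ∧
      ∀ i ∈ P₁, ∀ l ∈ P₂, ∀ m, m ∉ P₁ → m ∉ P₂ →
        q i * (if m ∈ M₁ then 1 else 0) + q l * (if m ∈ M₂ then 1 else 0) + q m = 0 := by
  obtain ⟨hdeg, F, hF, hFE, ho⟩ := hp
  obtain ⟨c, L, Q, hQ, rfl⟩ := exists_eq_sum_of_totalDegree_le_two hdeg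
  let P : (Fin n → ℝ) → ℝ := fun x =>
    c + ∑ i, L i * x i + ∑ i, ∑ j, Q i j * (x i * x j)
  have hPe : ∀ v, eval v (C c + ∑ i, C (L i) * X i + ∑ i, ∑ j, C (Q i j) * (X i * X j)) = P v := by
    intro v
    simp [P]
  simp only [hPe] at ho
  have hPc : ContDiff ℝ 2 P := by
    simp only [P]
    fun_prop
  have hG : ContDiff ℝ 2 fun v => F v - P v := ContDiff.sub (by exact_mod_cast hF) hPc
  obtain ⟨hG0, hG1, hG2⟩ := fderiv_fderiv_eq_zero_of_isLittleO hG ho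
  have hc : c = 0 := by
    have : P 0 = c := by simp [P]
    rw [hFE 0 h0, this] at hG0
    linarith
  have hmix : ∀ ε > 0, ∃ δ > 0, ∀ x a b : Fin n → ℝ, (x ∈ E ∧ ‖x‖ < δ) →
      (x + a ∈ E ∧ ‖x + a‖ < δ) → (x + b ∈ E ∧ ‖x + b‖ < δ) →
      (x + a + b ∈ E ∧ ‖x + a + b‖ < δ) →
      |∑ i, ∑ j, Q i j * (a i * b j)| ≤ ‖a‖ * ‖b‖ * ε := by
    intro ε hε
    obtain ⟨δ, hδ, H⟩ := hG.exists_norm_mixed_difference_le hG2 hε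
    refine ⟨δ, hδ, fun x a b hx hxa hxb hxab => ?_⟩
    have key := H x a b hx.2 hxa.2 hxb.2 hxab.2
    rw [hFE _ hx.1, hFE _ hxa.1, hFE _ hxb.1, hFE _ hxab.1] at key
    have hsymm : ∑ i, ∑ j, Q i j * (b i * a j) = ∑ i, ∑ j, Q i j * (a i * b j) := by
      rw [Finset.sum_comm]
      exact Finset.sum_congr rfl fun i _ => Finset.sum_congr rfl fun j _ => by rw [hQ]; ring
    have e : 0 - P (x + a + b) - (0 - P (x + a)) - (0 - P (x + b)) + (0 - P x) =
        -(∑ i, ∑ j, Q i j * (a i * b j) + ∑ i, ∑ j, Q i j * (b i * a j)) := by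
      simp only [P, Pi.add_apply, mul_add, add_mul, Finset.sum_add_distrib]
      ring
    rw [e, hsymm, abs_neg, ← two_mul, abs_mul, abs_two] at key
    have : 0 ≤ |∑ i, ∑ j, Q i j * (a i * b j)| := abs_nonneg _
    linarith
  have hsingle : ∀ i j α β, ∑ k, ∑ l, Q k l *
      ((Pi.single i α : Fin n → ℝ) k * (Pi.single j β : Fin n → ℝ) l) = Q i j * (α * β) := by
    intro i j α β
    simp [Pi.single_apply]
  have hflip : ∀ (z : Fin n → ℝ) (i k : Fin n),
      (z + Pi.single i (-2 * z i) : Fin n → ℝ) k ^ 2 = z k ^ 2 := by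
    intro z i k
    by_cases hk : k = i
    · subst hk
      simp only [Pi.add_apply, Pi.single_eq_same]
      ring
    · simp [hk]
  have hoff : ∀ i j, i ≠ j → Q i j = 0 := by
    intro i j hij
    refine eq_zero_of_forall_abs_le_mul (K := 1) fun ε hε => ?_
    obtain ⟨δ, hδ, H⟩ := hmix ε hε
    obtain ⟨z, hz, hzE⟩ := h.exists_ne_zero hP h₁ h₂ hN hδ
    have hfj : (z + Pi.single i (-2 * z i) : Fin n → ℝ) j = z j := by simp [hij.symm]
    have key := H z (Pi.single i (-2 * z i)) (Pi.single j (-2 * z j)) (hzE z fun _ => rfl)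
      (hzE _ (hflip z i)) (hzE _ (hflip z j)) (hzE _ fun k => by
        have := hflip (z + Pi.single i (-2 * z i)) j k
        rw [hfj] at this
        rw [this, hflip])
    rw [hsingle, Pi.norm_single, Pi.norm_single, abs_mul, ← Real.norm_eq_abs (_ * _),
      norm_mul] at key
    have : 0 < ‖-2 * z i‖ * ‖-2 * z j‖ :=
      mul_pos (norm_pos_iff.2 (mul_ne_zero (by norm_num) (hz i)))
        (norm_pos_iff.2 (mul_ne_zero (by norm_num) (hz j)))
    rw [mul_comm |Q i j|] at key
    linarith [le_of_mul_le_mul_left key this]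
  have hPd : ∀ x, P x = ∑ i, L i * x i + ∑ i, Q i i * x i ^ 2 := by
    intro x
    simp only [P, hc, zero_add]
    congr 1
    refine Finset.sum_congr rfl fun i _ => ?_
    rw [Finset.sum_eq_single i (fun j _ hj => by rw [hoff i j hj.symm, zero_mul]) (by simp), sq]
  have hL : ∀ i, L i = 0 := by
    intro i
    refine eq_zero_of_forall_abs_le_mul (K := 1) fun ε hε => ?_
    obtain ⟨δ, hδ, H⟩ := hG.exists_norm_difference_le hG1 hε
    obtain ⟨z, hz, hzE⟩ := h.exists_ne_zero hP h₁ h₂ hN hδ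
    obtain ⟨hx, hx'⟩ := hzE z fun _ => rfl
    obtain ⟨ha, ha'⟩ := hzE _ (hflip z i)
    have key := H z (Pi.single i (-2 * z i)) hx' ha'
    rw [hFE _ hx, hFE _ ha, hPd, hPd] at key
    simp only [hflip] at key
    have e : ∑ k, L k * (z + Pi.single i (-2 * z i) : Fin n → ℝ) k =
        ∑ k, L k * z k + L i * (-2 * z i) := by
      simp [mul_add, Finset.sum_add_distrib, Pi.single_apply]
    rw [e, Pi.norm_single, Real.norm_eq_abs] at key
    have e' : 0 - (∑ k, L k * z k + L i * (-2 * z i) + ∑ k, Q k k * z k ^ 2) -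
      (0 - (∑ k, L k * z k + ∑ k, Q k k * z k ^ 2)) = -(L i * (-2 * z i)) := by ring
    rw [e', abs_neg, abs_mul] at key
    have : 0 < |-2 * z i| := by
      have := hz i
      positivity
    linarith [le_of_mul_le_mul_right key this]
  have hrot : ∀ {P₁ P₂ M₁ M₂ : Finset (Fin n)}, HasSmallPoints E P₁ P₂ M₁ M₂ →
      Disjoint P₁ P₂ → P₂.Nonempty → (∃ k, k ∉ P₁ ∧ k ∉ P₂) →
      ∀ i ∈ P₁, ∀ j ∈ P₁, Q i i = Q j j := by
    intro P₁ P₂ M₁ M₂ h hP h₂ hN i hi j hj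
    rw [← sub_eq_zero]
    refine eq_zero_of_forall_abs_le_mul (K := 4) fun ε hε => ?_
    obtain ⟨δ, hδ, H⟩ := hmix ε hε
    obtain ⟨r, w, hr, hw⟩ := h.exists_sphere hP h₂ hN hδ
    have ha : w + Pi.single i r + (Pi.single j r - Pi.single i r) = w + Pi.single j r := by abel
    have hb : w + Pi.single i r + (-Pi.single i r - Pi.single j r) = w + Pi.single j (-r) := by
      rw [Pi.single_neg]; abel
    have hab : w + Pi.single i r + (Pi.single j r - Pi.single i r) +
        (-Pi.single i r - Pi.single j r) = w + Pi.single i (-r) := by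
      rw [Pi.single_neg]; abel
    have key := H (w + Pi.single i r) (Pi.single j r - Pi.single i r)
      (-Pi.single i r - Pi.single j r) (hw i hi r rfl) (by rw [ha]; exact hw j hj r rfl)
      (by rw [hb]; exact hw j hj _ (neg_sq r)) (by rw [hab]; exact hw i hi _ (neg_sq r))
    have e : ∑ k, ∑ l, Q k l * ((Pi.single j r - Pi.single i r : Fin n → ℝ) k *
        (-Pi.single i r - Pi.single j r : Fin n → ℝ) l) = (Q i i - Q j j) * r ^ 2 := by
      simp only [Pi.sub_apply, Pi.neg_apply, sub_mul, mul_sub, mul_neg, Finset.sum_sub_distrib,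
        Finset.sum_neg_distrib, hsingle, hQ j i]
      ring
    have n₁ : ‖(Pi.single j r - Pi.single i r : Fin n → ℝ)‖ ≤ 2 * r := by
      refine (norm_sub_le _ _).trans ?_
      rw [Pi.norm_single, Pi.norm_single, Real.norm_eq_abs, abs_of_pos hr]
      linarith
    have n₂ : ‖(-Pi.single i r - Pi.single j r : Fin n → ℝ)‖ ≤ 2 * r := by
      refine (norm_sub_le _ _).trans ?_
      rw [norm_neg, Pi.norm_single, Pi.norm_single, Real.norm_eq_abs, abs_of_pos hr]
      linarith
    rw [e, abs_mul, abs_of_pos (by positivity : 0 < r ^ 2)] at key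
    have : ‖(Pi.single j r - Pi.single i r : Fin n → ℝ)‖ *
        ‖(-Pi.single i r - Pi.single j r : Fin n → ℝ)‖ * ε ≤ 2 * r * (2 * r) * ε := by
      gcongr
    refine le_of_mul_le_mul_right ?_ (by positivity : 0 < r ^ 2)
    linarith
  refine ⟨fun i => Q i i, ?_, hrot h hP h₂ hN,
    hrot h.symm hP.symm h₁ (hN.imp fun _ hk => hk.symm), fun i hi l hl m hm hm' => ?_⟩
  · refine MvPolynomial.funext fun x => ?_
    rw [hPe, hPd]
    simp [hL]
  · set u₁ : ℝ := if m ∈ M₁ then 1 else 0 with hu₁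
    set u₂ : ℝ := if m ∈ M₂ then 1 else 0 with hu₂
    have hu₁' : u₁ ≤ 1 := by rw [hu₁]; split_ifs <;> norm_num
    have hu₂' : u₂ ≤ 1 := by rw [hu₂]; split_ifs <;> norm_num
    refine eq_zero_of_forall_abs_le_mul (K := |Q i i| + |Q l l| + 5) fun ε' hε' => ?_
    set ε := min ε' 1 with hεε
    have hε : 0 < ε := lt_min hε' one_pos
    have hε1 : ε ≤ 1 := min_le_right _ _
    obtain ⟨δ, hδ, H⟩ := Metric.eventually_nhds_iff.1 (ho.def hε)
    obtain ⟨t, r₁, r₂, ht, b₁, b₂, x, hxE, hx, hx', hq⟩ :=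
      h.exists_axis hP hi hl hm hm' (lt_min hε hδ)
    have key := H (y := x) (by simpa using hx.trans_le (min_le_right _ _))
    rw [hFE x hxE, hPd, hq] at key
    simp only [hL, zero_mul, Finset.sum_const_zero, zero_add, zero_sub, norm_neg, norm_pow,
      norm_norm] at key
    rw [Real.norm_eq_abs] at key
    rw [← hu₁] at b₁
    rw [← hu₂] at b₂
    have ht2 : 0 < t ^ 2 := by positivity
    have hmin : min ε δ * t ^ 2 ≤ ε * t ^ 2 := by gcongr; exact min_le_left _ _
    replace b₁ := b₁.trans hmin
    replace b₂ := b₂.trans hmin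
    have c₁ : r₁ ^ 2 ≤ 2 * t ^ 2 := by nlinarith [(abs_le.1 b₁).2]
    have c₂ : r₂ ^ 2 ≤ 2 * t ^ 2 := by nlinarith [(abs_le.1 b₂).2]
    have hK : |Q i i * r₁ ^ 2 + Q l l * r₂ ^ 2 + Q m m * t ^ 2| ≤ 5 * ε * t ^ 2 := by
      refine key.trans ?_
      calc ε * ‖x‖ ^ 2 ≤ ε * (5 * t ^ 2) := by gcongr; linarith
        _ = _ := by ring
    have e : (Q i i * u₁ + Q l l * u₂ + Q m m) * t ^ 2 =
        (Q i i * r₁ ^ 2 + Q l l * r₂ ^ 2 + Q m m * t ^ 2) - Q i i * (r₁ ^ 2 - t ^ 2 * u₁) -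
          Q l l * (r₂ ^ 2 - t ^ 2 * u₂) := by ring
    have hfin : |Q i i * u₁ + Q l l * u₂ + Q m m| * t ^ 2 ≤
        ((|Q i i| + |Q l l| + 5) * ε) * t ^ 2 := by
      rw [← abs_of_pos ht2, ← abs_mul, e, abs_of_pos ht2]
      refine (abs_sub _ _).trans ?_
      have := abs_sub (Q i i * r₁ ^ 2 + Q l l * r₂ ^ 2 + Q m m * t ^ 2)
        (Q i i * (r₁ ^ 2 - t ^ 2 * u₁))
      rw [abs_mul (Q i i)] at this
      rw [abs_mul (Q l l)]
      have := mul_le_mul_of_nonneg_left b₁ (abs_nonneg (Q i i))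
      have := mul_le_mul_of_nonneg_left b₂ (abs_nonneg (Q l l))
      linarith
    refine (le_of_mul_le_mul_right hfin ht2).trans ?_
    gcongr
    exact min_le_left _ _

theorem sum_compl_union {n : ℕ} {A B C D : Finset (Fin n)} (hAC : Disjoint A C)
    (hAD : Disjoint A D) (hBC : Disjoint B C) (hBD : Disjoint B D) (hCD : Disjoint C D)
    (f : Fin n → ℝ) :
    ∑ i ∈ (A ∪ B)ᶜ, f i = ∑ i ∈ C, f i + ∑ i ∈ D, f i + ∑ i ∈ (A ∪ B ∪ C ∪ D)ᶜ, f i := by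
  rw [← Finset.sum_union hCD, ← Finset.sum_union]
  · congr 1
    ext k
    have := @Finset.disjoint_left.1 hAC
    have := @Finset.disjoint_left.1 hAD
    have := @Finset.disjoint_left.1 hBC
    have := @Finset.disjoint_left.1 hBD
    simp only [Finset.mem_compl, Finset.mem_union]
    grind
  · rw [Finset.disjoint_left]
    intro k
    simp only [Finset.mem_compl, Finset.mem_union]
    tauto

theorem hasSmallPoints_quartic {n : ℕ} {J1p J1m J2p J2m : Finset (Fin n)}
    (h12 : Disjoint J1p J1m) (h13 : Disjoint J1p J2p) (h14 : Disjoint J1p J2m)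
    (h23 : Disjoint J1m J2p) (h24 : Disjoint J1m J2m) (h34 : Disjoint J2p J2m) :
    HasSmallPoints {x : Fin n → ℝ |
        ((∑ i ∈ J1p, x i ^ 2) - (∑ i ∈ J1m, x i ^ 2)
            - (∑ i ∈ (J1p ∪ J1m)ᶜ, x i ^ 2) ^ 2 = 0) ∧
        ((∑ i ∈ J2p, x i ^ 2) - (∑ i ∈ J2m, x i ^ 2)
            - (∑ i ∈ (J2p ∪ J2m)ᶜ, x i ^ 2) ^ 2 = 0)} J1p J2p J1m J2m := by
  rintro y ⟨k, hk₁, hk₂, hk⟩ ε hε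
  set Z := (J1p ∪ J1m ∪ J2p ∪ J2m)ᶜ with hZ
  have hZ' : (J2p ∪ J2m ∪ J1p ∪ J1m)ᶜ = Z := by
    rw [hZ]
    congr 1
    ext
    simp only [Finset.mem_union]
    tauto
  set b₁ := ∑ k ∈ J1m, y k ^ 2 with hb₁
  set b₂ := ∑ k ∈ J2m, y k ^ 2 with hb₂
  set c := ∑ k ∈ Z, y k ^ 2 with hc
  have nb₁ : 0 ≤ b₁ := Finset.sum_nonneg fun _ _ => sq_nonneg _
  have nb₂ : 0 ≤ b₂ := Finset.sum_nonneg fun _ _ => sq_nonneg _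
  have nc : 0 ≤ c := Finset.sum_nonneg fun _ _ => sq_nonneg _
  have hpos : 0 < b₁ + b₂ + c := by
    have hy : 0 < y k ^ 2 := by positivity
    have hle : ∀ s : Finset (Fin n), k ∈ s → y k ^ 2 ≤ ∑ k ∈ s, y k ^ 2 := fun s hs =>
      Finset.single_le_sum (f := fun k => y k ^ 2) (fun _ _ => sq_nonneg _) hs
    by_cases h1 : k ∈ J1m
    · linarith [hle _ h1]
    by_cases h2 : k ∈ J2m
    · linarith [hle _ h2]
    have h3 : k ∈ Z := by simp [*]
    linarith [hle _ h3]
  set T := b₁ + b₂ + c with hT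
  have ev : ∀ (K η : ℝ), 0 < η → ∀ᶠ t in 𝓝[>] (0 : ℝ), K * t ^ 2 < η := by
    intro K η hη
    have : Tendsto (fun t : ℝ => K * t ^ 2) (𝓝 0) (𝓝 0) := by
      have : Continuous fun t : ℝ => K * t ^ 2 := by fun_prop
      simpa using this.tendsto 0
    exact (this.mono_left nhdsWithin_le_nhds).eventually_lt_const hη
  have ev' : ∀ᶠ t in 𝓝[>] (0 : ℝ), t < ε :=
    (tendsto_id.mono_left nhdsWithin_le_nhds).eventually_lt_const hε
  obtain ⟨t, ht, t1, t2, t3, t4⟩ := (eventually_mem_nhdsWithin.and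
    ((ev T (1 / 100) (by norm_num)).and ((ev (9 * T ^ 2) ε hε).and ((ev (2 * T) (ε ^ 2) (by positivity)).and ev')))).exists
  replace ht : 0 < t := ht
  have ht2 : 0 < t ^ 2 := by positivity
  have eT : t ^ 2 * b₁ + t ^ 2 * b₂ + t ^ 2 * c = T * t ^ 2 := by rw [hT]; ring
  obtain ⟨a₁, a₂, pa₁, pa₂, la₁, la₂, e₁, e₂⟩ := exists_pos_balanced
    (mul_nonneg ht2.le nb₁) (mul_nonneg ht2.le nb₂) (mul_nonneg ht2.le nc)
    (by rw [eT]; positivity) (by rw [eT]; exact t1.le)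
  rw [eT] at la₁ la₂
  have hbT : b₂ * t ^ 2 + c * t ^ 2 ≤ T * t ^ 2 := by rw [hT]; nlinarith
  have hbT' : b₁ * t ^ 2 + c * t ^ 2 ≤ T * t ^ 2 := by rw [hT]; nlinarith
  have hest : ∀ s, 0 ≤ s → s ≤ 3 * (T * t ^ 2) → |s ^ 2| ≤ ε * t ^ 2 := by
    intro s hs hs'
    rw [abs_of_nonneg (sq_nonneg s)]
    calc s ^ 2 ≤ (3 * (T * t ^ 2)) ^ 2 := by gcongr
      _ = (9 * T ^ 2 * t ^ 2) * t ^ 2 := by ring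
      _ ≤ _ := by gcongr
  refine ⟨t, √a₁, √a₂, ⟨ht, t4⟩, ⟨Real.sqrt_pos.2 pa₁, ?_⟩, ⟨Real.sqrt_pos.2 pa₂, ?_⟩, ?_, ?_, ?_⟩
  · rw [Real.sqrt_lt' hε]; linarith
  · rw [Real.sqrt_lt' hε]; linarith
  · have e : a₁ - t ^ 2 * b₁ = (a₂ + t ^ 2 * b₂ + t ^ 2 * c) ^ 2 := by linarith
    rw [Real.sq_sqrt pa₁.le, e]
    exact hest _ (by positivity) (by linarith)
  · have e : a₂ - t ^ 2 * b₂ = (a₁ + t ^ 2 * b₁ + t ^ 2 * c) ^ 2 := by linarith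
    rw [Real.sq_sqrt pa₂.le, e]
    exact hest _ (by positivity) (by linarith)
  · intro x hx₁ hx₂ hx
    rw [Real.sq_sqrt pa₁.le] at hx₁
    rw [Real.sq_sqrt pa₂.le] at hx₂
    have hs : ∀ s : Finset (Fin n), Disjoint J1p s → Disjoint J2p s →
        ∑ k ∈ s, x k ^ 2 = t ^ 2 * ∑ k ∈ s, y k ^ 2 := by
      intro s hs₁ hs₂
      rw [Finset.mul_sum]
      refine Finset.sum_congr rfl fun k hk => ?_
      rw [hx k (Finset.disjoint_right.1 hs₁ hk) (Finset.disjoint_right.1 hs₂ hk), mul_pow]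
    have hZ₁ : Disjoint J1p Z := by
      rw [Finset.disjoint_left]
      intro k hk
      simp [hZ, hk]
    have hZ₂ : Disjoint J2p Z := by
      rw [Finset.disjoint_left]
      intro k hk
      simp [hZ, hk]
    rw [Set.mem_ofPred_eq, sum_compl_union h13 h14 h23 h24 h34,
      sum_compl_union h13.symm h23.symm h14.symm h24.symm h12, hZ', ← hZ, hx₁, hx₂,
      hs _ h12 h23.symm, hs _ h14 h34, hs _ hZ₁ hZ₂, ← hb₁, ← hb₂, ← hc]
    exact ⟨by linarith, by linarith⟩

theorem truncIdeal_subset_Im_quartic {n : ℕ} (A₁ B₁ C₁ A₂ B₂ C₂ : Finset (Fin n)) :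
    truncIdeal n 2
        ![(∑ i ∈ A₁, X i ^ 2) - (∑ i ∈ B₁, (X i : MvPolynomial (Fin n) ℝ) ^ 2),
          (∑ i ∈ A₂, X i ^ 2) - (∑ i ∈ B₂, X i ^ 2)] ⊆
      Im n 2 {x : Fin n → ℝ |
        ((∑ i ∈ A₁, x i ^ 2) - (∑ i ∈ B₁, x i ^ 2) - (∑ i ∈ C₁, x i ^ 2) ^ 2 = 0) ∧
        ((∑ i ∈ A₂, x i ^ 2) - (∑ i ∈ B₂, x i ^ 2) - (∑ i ∈ C₂, x i ^ 2) ^ 2 = 0)} := by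
  rintro p ⟨hdeg, q, hq⟩
  refine ⟨hdeg, fun x => eval 0 (q 0) *
      ((∑ i ∈ A₁, x i ^ 2) - (∑ i ∈ B₁, x i ^ 2) - (∑ i ∈ C₁, x i ^ 2) ^ 2) + eval 0 (q 1) *
      ((∑ i ∈ A₂, x i ^ 2) - (∑ i ∈ B₂, x i ^ 2) - (∑ i ∈ C₂, x i ^ 2) ^ 2), by fun_prop, ?_, ?_⟩
  · rintro x ⟨hx₁, hx₂⟩
    simp only [hx₁, hx₂, mul_zero, add_zero]
  have hR := isLittleO_eval_of_coeff_eq_zero hq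
  have hfactor : ∀ (q : MvPolynomial (Fin n) ℝ) (A B : Finset (Fin n)),
      (fun v : Fin n → ℝ => (eval 0 q - eval v q) * (∑ i ∈ A, v i ^ 2 - ∑ i ∈ B, v i ^ 2))
        =o[𝓝 0] fun v => ‖v‖ ^ 2 := by
    intro q A B
    have h1 : (fun v : Fin n → ℝ => eval 0 q - eval v q) =o[𝓝 0] fun _ => (1 : ℝ) := by
      rw [isLittleO_one_iff]
      have : Continuous fun v : Fin n → ℝ => eval 0 q - eval v q :=
        continuous_const.sub (MvPolynomial.continuous_eval q)
      simpa using this.tendsto 0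
    simpa using h1.mul_isBigO ((isBigO_sum_sq A).sub (isBigO_sum_sq B))
  have hquart : ∀ (r : ℝ) (A : Finset (Fin n)),
      (fun v : Fin n → ℝ => r * (∑ i ∈ A, v i ^ 2) ^ 2) =o[𝓝 0] fun v => ‖v‖ ^ 2 := by
    intro r A
    refine IsLittleO.const_mul_left (((isBigO_sum_sq A).pow 2).trans_isLittleO ?_) r
    simp only [← pow_mul]
    exact isLittleO_norm_pow_norm_pow (by norm_num)
  refine (((((hfactor (q 0) A₁ B₁).add (hfactor (q 1) A₂ B₂)).sub (hquart (eval 0 (q 0)) C₁)).sub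
    (hquart (eval 0 (q 1)) C₂)).sub hR).congr_left fun v => ?_
  simp only [Fin.sum_univ_two, Matrix.cons_val_zero, Matrix.cons_val_one, map_sub, map_add,
    map_mul, map_sum, map_pow, eval_X]
  ring

/-- For pairwise disjoint `J¹₊, J¹₋, J²₊, J²₋ ⊆ {1,…,n}` with `J¹₊, J²₊ ≠ ∅` and
`J¹₋ ∪ J²₋ ∪ J₀ ≠ ∅` (where `J₀` is the complement of their union), setting
`p_α = Σ_{J^α₊} xᵢ² − Σ_{J^α₋} xᵢ²` and `q_α = p_α − (Σ_{i∉J^α₊∪J^α₋} xᵢ²)²`,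
one has `I²({q₁ = q₂ = 0}) = ⟨p₁, p₂⟩₂`. -/
theorem stmt15 (n : ℕ) (hn : 2 ≤ n) (J1p J1m J2p J2m : Finset (Fin n))
    (h12 : Disjoint J1p J1m) (h13 : Disjoint J1p J2p) (h14 : Disjoint J1p J2m)
    (h23 : Disjoint J1m J2p) (h24 : Disjoint J1m J2m) (h34 : Disjoint J2p J2m)
    (h1p : J1p.Nonempty) (h2p : J2p.Nonempty)
    (hneg : (J1m ∪ J2m ∪ (Finset.univ \ (J1p ∪ J1m ∪ J2p ∪ J2m))).Nonempty) :
    Im n 2 {x : Fin n → ℝ |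
        ((∑ i ∈ J1p, x i ^ 2) - (∑ i ∈ J1m, x i ^ 2)
            - (∑ i ∈ (J1p ∪ J1m)ᶜ, x i ^ 2) ^ 2 = 0) ∧
        ((∑ i ∈ J2p, x i ^ 2) - (∑ i ∈ J2m, x i ^ 2)
            - (∑ i ∈ (J2p ∪ J2m)ᶜ, x i ^ 2) ^ 2 = 0)} =
      truncIdeal n 2
        ![(∑ i ∈ J1p, X i ^ 2) - (∑ i ∈ J1m, (X i : MvPolynomial (Fin n) ℝ) ^ 2),
          (∑ i ∈ J2p, X i ^ 2) - (∑ i ∈ J2m, X i ^ 2)] := by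
  refine Set.Subset.antisymm (fun p hp => ?_) (truncIdeal_subset_Im_quartic _ _ _ _ _ _)
  have d12 := @Finset.disjoint_left.1 h12
  have d13 := @Finset.disjoint_left.1 h13
  have d14 := @Finset.disjoint_left.1 h14
  have d23 := @Finset.disjoint_left.1 h23
  have d24 := @Finset.disjoint_left.1 h24
  have d34 := @Finset.disjoint_left.1 h34
  have hN : ∃ k, k ∉ J1p ∧ k ∉ J2p := by
    obtain ⟨k, hk⟩ := hneg
    simp only [Finset.mem_union, Finset.mem_sdiff, Finset.mem_univ, true_and] at hk
    exact ⟨k, by grind, by grind⟩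
  refine ⟨hp.1, ?_⟩
  obtain ⟨q, rfl, hq₁, hq₂, hq⟩ :=
    (hasSmallPoints_quartic h12 h13 h14 h23 h24 h34).exists_diagonal_of_mem_Im (by simp) h13 h1p h2p hN hp
  obtain ⟨i, hi⟩ := h1p
  obtain ⟨l, hl⟩ := h2p
  have hqk : ∀ k, q k = q i * ((if k ∈ J1p then 1 else 0) - (if k ∈ J1m then 1 else 0)) +
      q l * ((if k ∈ J2p then 1 else 0) - (if k ∈ J2m then 1 else 0)) := by
    intro k
    by_cases h1 : k ∈ J1p
    · simp [h1, d12 h1, d13 h1, d14 h1, hq₁ k h1 i hi]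
    by_cases h2 : k ∈ J2p
    · simp [h1, h2, d34 h2, Finset.disjoint_right.1 h23 h2, hq₂ k h2 l hl]
    have := hq i hi l hl k h1 h2
    simp only [h1, h2, if_false]
    linarith
  refine ⟨![C (q i), C (q l)], fun d _ => ?_⟩
  have : ∑ k, C (q k) * X k ^ 2 = C (q i) * ((∑ k ∈ J1p, X k ^ 2) - ∑ k ∈ J1m, X k ^ 2) +
      C (q l) * ((∑ k ∈ J2p, X k ^ 2) - ∑ k ∈ J2m, (X k : MvPolynomial (Fin n) ℝ) ^ 2) := by
    refine MvPolynomial.funext fun x => ?_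
    simp only [map_sum, map_add, map_mul, map_sub, map_pow, eval_C, eval_X]
    rw [Finset.sum_congr rfl fun k _ => by rw [hqk k]]
    simp only [add_mul, mul_sub, sub_mul, Finset.sum_add_distrib, Finset.sum_sub_distrib, mul_ite,
      ite_mul, mul_one, mul_zero, zero_mul, Finset.sum_ite_mem, Finset.univ_inter, Finset.mul_sum]
  simp [Fin.sum_univ_two, this]
end

section
/- Let E = {(x,y,z) ∈ ℝ³ : x² − y² − z⁴ = 0 and z² − (x² + y²)² = 0}. Then for every ε > 0 there exists a point (x,y,z) ∈ E with 0 < ‖(x,y,z)‖ < ε and x·y·z ≠ 0. -/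
/-- The set `E = {x² − y² − z⁴ = 0, z² − (x² + y²)² = 0} ⊆ ℝ³` contains points arbitrarily
close to (but distinct from) the origin with all three coordinates nonzero. -/
theorem stmt16 :
    ∀ ε > (0 : ℝ), ∃ x y z : ℝ,
      (x ^ 2 - y ^ 2 - z ^ 4 = 0 ∧ z ^ 2 - (x ^ 2 + y ^ 2) ^ 2 = 0) ∧
      0 < Real.sqrt (x ^ 2 + y ^ 2 + z ^ 2) ∧
      Real.sqrt (x ^ 2 + y ^ 2 + z ^ 2) < ε ∧
      x * y * z ≠ 0 := by
  intro ε hε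
  obtain ⟨t, ht0, ht1, htε⟩ : ∃ t : ℝ, 0 < t ∧ t < 1 ∧ 2 * t ≤ ε ^ 2 := by
    refine ⟨min (1 / 2) (ε ^ 2 / 2), by positivity, ?_, ?_⟩
    · linarith [min_le_left (1 / 2) (ε ^ 2 / 2)]
    · linarith [min_le_right (1 / 2) (ε ^ 2 / 2)]
  have h4 : t ^ 4 < t := pow_lt_self_of_lt_one₀ ht0 ht1 (by norm_num)
  have h2 : t ^ 2 < t := pow_lt_self_of_lt_one₀ ht0 ht1 (by norm_num)
  have hx : 0 < (t + t ^ 4) / 2 := by positivity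
  have hy : 0 < (t - t ^ 4) / 2 := by linarith
  refine ⟨√((t + t ^ 4) / 2), √((t - t ^ 4) / 2), t, ?_, ?_, ?_, ?_⟩
  · rw [Real.sq_sqrt hx.le, Real.sq_sqrt hy.le]
    constructor <;> ring
  · positivity
  · rw [Real.sqrt_lt' hε, Real.sq_sqrt hx.le, Real.sq_sqrt hy.le]
    linarith
  · positivity
end

section
/- Fix m ≥ 1. Let (a₁,b₁), …, (a_{m+1}, b_{m+1}) ∈ ℝ² ∖ {(0,0)} be pairwise non-proportional (a_i·b_j ≠ a_j·b_i for i ≠ j), defining m+1 distinct lines through the origin L_i = {(x,y) ∈ ℝ² : a_i x + b_i y = 0}. If f ∈ C^m(ℝ²) vanishes on L₁ ∪ ⋯ ∪ L_{m+1}, then the m-th degree Taylor polynomial of f at the origin is zero, i.e., f(v) = o(‖v‖^m) as v → 0. -/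
open Filter Asymptotics Topology

/-- All derivatives of a `C^m` function at the origin vanish along a line through the origin on
which the function vanishes. -/
lemma iteratedFDeriv_zero_apply_eq_zero_of_vanish_line {E : Type*} [NormedAddCommGroup E]
    [NormedSpace ℝ E] {m : ℕ} {f : E → ℝ} (hf : ContDiff ℝ m f) {v : E}
    (hv : ∀ s : ℝ, f (s • v) = 0) {k : ℕ} (hk : k ≤ m) :
    iteratedFDeriv ℝ k f 0 (fun _ => v) = 0 := by
  have key : ∀ k ≤ m, ∀ s : ℝ, iteratedFDeriv ℝ k f (0 + s • v) (fun _ => v) = 0 := by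
    intro k
    induction k with
    | zero => intro _ s; simpa using hv s
    | succ n ih =>
      intro hn s
      have hfs : ContDiffAt ℝ (n + 1) f (0 + s • v) :=
        (hf.of_le (by exact_mod_cast hn)).contDiffAt
      rw [← hfs.deriv_fderiv_add_smul, funext (ih (by omega))]
      simp
  simpa using key k hk 0

open Polynomial in
/-- A multilinear map along an affine line is polynomial, with the expected leading coefficient. -/
lemma ContinuousMultilinearMap.exists_polynomial_add_smul {E : Type*} [NormedAddCommGroup E]
    [NormedSpace ℝ E] {k : ℕ} (D : ContinuousMultilinearMap ℝ (fun _ : Fin k => E) ℝ) (u w : E) :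
    ∃ q : ℝ[X], q.degree < k ∧
      ∀ t : ℝ, D (fun _ => u + t • w) = q.eval t + t ^ k * D (fun _ => w) := by
  classical
  refine ⟨∑ s ∈ (Finset.univ : Finset (Finset (Fin k))).erase Finset.univ,
    C (D (s.piecewise (fun _ => w) (fun _ => u))) * X ^ s.card, ?_, fun t => ?_⟩
  · refine mem_degreeLT.mp (Submodule.sum_mem _ fun s hs => mem_degreeLT.mpr ?_)
    refine lt_of_le_of_lt (degree_C_mul_X_pow_le _ _) ?_
    have := Finset.card_lt_univ_of_notMem
      (Classical.choose_spec (not_forall.mp fun h =>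
        (Finset.ne_of_mem_erase hs) (Finset.eq_univ_iff_forall.mpr h)))
    rw [Fintype.card_fin] at this
    exact_mod_cast this
  · have hterm : ∀ s : Finset (Fin k), D (s.piecewise (fun _ => t • w) (fun _ => u)) =
        D (s.piecewise (fun _ => w) (fun _ => u)) * t ^ s.card := by
      intro s
      have := D.map_piecewise_smul (fun _ => t) (s.piecewise (fun _ => w) (fun _ => u)) s
      rw [Finset.prod_const, smul_eq_mul, mul_comm] at this
      rw [← this]
      congr 1
      ext i
      by_cases hi : i ∈ s <;> simp [hi]
    have hadd : (fun _ : Fin k => u + t • w) = (fun _ => t • w) + fun _ => u := by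
      ext; simp [add_comm]
    rw [hadd, D.map_add_univ, eval_finsetSum,
      ← Finset.sum_erase_add _ _ (Finset.mem_univ (Finset.univ : Finset (Fin k)))]
    congr 1
    · exact Finset.sum_congr rfl fun s _ => by rw [hterm]; simp
    · rw [hterm]; simp [mul_comm]

/-- A homogeneous form of degree `k ≤ m` on the plane which vanishes on `m + 1` distinct lines
through the origin is zero. -/
lemma ContinuousMultilinearMap.apply_const_eq_zero_of_vanish_lines {m k : ℕ} (hk : k ≤ m)
    {a b : Fin (m + 1) → ℝ}
    (hprop : ∀ i j : Fin (m + 1), i ≠ j → a i * b j ≠ a j * b i)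
    (D : ContinuousMultilinearMap ℝ (fun _ : Fin k => Fin 2 → ℝ) ℝ)
    (hD : ∀ v : Fin 2 → ℝ, (∃ i, a i * v 0 + b i * v 1 = 0) → D (fun _ => v) = 0)
    (u : Fin 2 → ℝ) : D (fun _ => u) = 0 := by
  by_cases hu : a 0 * u 0 + b 0 * u 1 = 0
  · exact hD u ⟨0, hu⟩
  set w : Fin 2 → ℝ := ![-b 0, a 0] with hw
  have hDw : D (fun _ => w) = 0 := hD w ⟨0, by simp [hw]; ring⟩
  obtain ⟨q, hqdeg, hq⟩ := D.exists_polynomial_add_smul u w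
  simp only [hDw, mul_zero, add_zero] at hq
  have hd : ∀ i : Fin m, a 0 * b i.succ - a i.succ * b 0 ≠ 0 := fun i =>
    sub_ne_zero.mpr (hprop 0 i.succ (Fin.succ_ne_zero i).symm)
  set t : Fin m → ℝ := fun i =>
    -(a i.succ * u 0 + b i.succ * u 1) / (a 0 * b i.succ - a i.succ * b 0) with ht
  have htinj : Function.Injective t := by
    intro i j hij
    by_contra hne
    rw [ht] at hij
    simp only at hij
    rw [div_eq_div_iff (hd i) (hd j)] at hij
    have : (a 0 * u 0 + b 0 * u 1) * (a i.succ * b j.succ - a j.succ * b i.succ) = 0 := by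
      linear_combination -hij
    rcases mul_eq_zero.mp this with h | h
    · exact hu h
    · exact hprop i.succ j.succ (fun h' => hne (Fin.succ_injective _ h')) (sub_eq_zero.mp h)
  have hq0 : q = 0 := by
    refine Polynomial.eq_zero_of_degree_lt_of_eval_index_eq_zero (s := Finset.univ) (v := t)
      htinj.injOn ?_ fun i _ => ?_
    · refine hqdeg.trans_le ?_
      simpa using hk
    · rw [← hq]
      refine hD _ ⟨i.succ, ?_⟩
      have h := div_mul_cancel₀ (-(a i.succ * u 0 + b i.succ * u 1)) (hd i)
      change t i * _ = _ at h
      simp only [hw, Pi.add_apply, Pi.smul_apply, smul_eq_mul, Matrix.cons_val_zero,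
        Matrix.cons_val_one]
      linear_combination h
  simpa [hq0] using hq 0

/-- A `C^m` function whose derivatives up to order `m` vanish on the diagonal at the origin is
`o(‖v‖^m)`. -/
lemma isLittleO_pow_of_iteratedFDeriv_zero {E : Type*} [NormedAddCommGroup E]
    [NormedSpace ℝ E] {m : ℕ} (hm : 1 ≤ m) {f : E → ℝ} (hf : ContDiff ℝ m f)
    (h0 : ∀ k ≤ m, ∀ v : E, iteratedFDeriv ℝ k f 0 (fun _ => v) = 0) :
    f =o[𝓝 0] (fun v => ‖v‖ ^ m) := by
  obtain ⟨n, rfl⟩ : ∃ n, m = n + 1 := ⟨m - 1, by omega⟩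
  rw [isLittleO_iff]
  intro ε hε
  have hcont : Continuous (iteratedFDeriv ℝ (n + 1) f) := hf.continuous_iteratedFDeriv le_rfl
  obtain ⟨δ, hδ, hball⟩ := Metric.continuousAt_iff.mp (hcont.continuousAt (x := 0)) ε hε
  filter_upwards [Metric.ball_mem_nhds 0 hδ] with v hv
  have htaylor := map_add_eq_sum_add_integral_iteratedFDeriv (f := f) (x := 0) (y := v) (n := n)
    fun t _ => by exact_mod_cast hf.contDiffAt
  rw [Finset.sum_eq_zero fun k hk => by
    rw [h0 k (by have := Finset.mem_range.mp hk; omega), smul_zero]] at htaylor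
  rw [zero_add, zero_add] at htaylor
  have hint : ‖∫ t in (0 : ℝ)..1,
      (1 - t) ^ n • iteratedFDeriv ℝ (n + 1) f (0 + t • v) (fun _ => v)‖ ≤
      ε * ‖v‖ ^ (n + 1) * |1 - 0| := by
    refine intervalIntegral.norm_integral_le_of_norm_le_const fun t ht => ?_
    rw [Set.uIoc_of_le zero_le_one] at ht
    have htv : dist (0 + t • v) 0 < δ := by
      rw [mem_ball_zero_iff] at hv
      rw [zero_add, dist_zero_right, norm_smul, Real.norm_of_nonneg ht.1.le]
      exact (mul_le_of_le_one_left (norm_nonneg v) ht.2).trans_lt hv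
    have hD := (hball htv).le
    rw [dist_eq_norm] at hD
    have hop := (iteratedFDeriv ℝ (n + 1) f (0 + t • v) - iteratedFDeriv ℝ (n + 1) f 0).le_opNorm
      (fun _ => v)
    rw [sub_apply, h0 (n + 1) le_rfl, sub_zero, Finset.prod_const,
      Finset.card_univ, Fintype.card_fin] at hop
    have hpow : ‖(1 - t) ^ n‖ ≤ 1 := by
      rw [norm_pow, Real.norm_of_nonneg (by linarith [ht.2])]
      exact pow_le_one₀ (by linarith [ht.2]) (by linarith [ht.1])
    rw [norm_smul]
    calc _ ≤ 1 * (ε * ‖v‖ ^ (n + 1)) := by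
          gcongr
          exact hop.trans (by gcongr)
      _ = _ := one_mul _
  rw [htaylor, norm_smul, norm_pow, norm_norm]
  have hfac : ‖((n.factorial : ℝ))⁻¹‖ ≤ 1 := by
    rw [norm_inv, RCLike.norm_natCast]
    exact inv_le_one_of_one_le₀ (by exact_mod_cast n.factorial_pos)
  calc _ ≤ 1 * (ε * ‖v‖ ^ (n + 1) * |1 - 0|) := by gcongr
    _ = _ := by simp

/-- A `C^m` function on `ℝ²` vanishing on `m + 1` distinct lines through the origin has
zero `m`-th degree Taylor polynomial at the origin, i.e. `f(v) = o(‖v‖^m)` as `v → 0`. -/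
theorem stmt17 (m : ℕ) (hm : 1 ≤ m) (a b : Fin (m + 1) → ℝ)
    (hne : ∀ i, (a i, b i) ≠ (0, 0))
    (hprop : ∀ i j : Fin (m + 1), i ≠ j → a i * b j ≠ a j * b i)
    (f : (Fin 2 → ℝ) → ℝ) (hf : ContDiff ℝ m f)
    (hvanish : ∀ v : Fin 2 → ℝ, (∃ i, a i * v 0 + b i * v 1 = 0) → f v = 0) :
    (fun v : Fin 2 → ℝ => f v) =o[𝓝 (0 : Fin 2 → ℝ)] (fun v => ‖v‖ ^ m) := by
  refine isLittleO_pow_of_iteratedFDeriv_zero hm hf fun k hk v => ?_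
  refine ContinuousMultilinearMap.apply_const_eq_zero_of_vanish_lines hk hprop _ ?_ v
  rintro u ⟨i, hi⟩
  refine iteratedFDeriv_zero_apply_eq_zero_of_vanish_line hf (fun s => hvanish _ ⟨i, ?_⟩) hk
  simp only [Pi.smul_apply, smul_eq_mul]
  linear_combination s * hi
end

section
/- Let E = {(x,y) ∈ ℝ² : x² = y³}. Then I³(E) = ⟨x² − y³⟩₃. -/
open MvPolynomial Filter Asymptotics Topology

namespace CuspIdeal

/-- The exponent vector of the monomial `x ^ i * y ^ j`. -/
noncomputable def bidegree (i j : ℕ) : Fin 2 →₀ ℕ := Finsupp.single 0 i + Finsupp.single 1 j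

@[simp] lemma bidegree_zero (i j : ℕ) : bidegree i j 0 = i := by simp [bidegree]

@[simp] lemma bidegree_one (i j : ℕ) : bidegree i j 1 = j := by simp [bidegree]

lemma bidegree_self (d : Fin 2 →₀ ℕ) : bidegree (d 0) (d 1) = d := by
  ext k; fin_cases k <;> simp

lemma bidegree_inj {i j k l : ℕ} : bidegree i j = bidegree k l ↔ i = k ∧ j = l := by
  constructor
  · intro h
    exact ⟨by simpa using DFunLike.congr_fun h 0, by simpa using DFunLike.congr_fun h 1⟩
  · rintro ⟨rfl, rfl⟩; rfl

lemma degree_eq (d : Fin 2 →₀ ℕ) : (d.sum fun _ e => e) = d 0 + d 1 := by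
  rw [Finsupp.sum_fintype _ _ (fun _ => rfl), Fin.sum_univ_two]

lemma coeff_bidegree_eq_zero {p : MvPolynomial (Fin 2) ℝ} {m i j : ℕ} (hp : p.totalDegree ≤ m)
    (h : m < i + j) : coeff (bidegree i j) p = 0 := by
  by_contra hne
  have := le_totalDegree (mem_support_iff.mpr hne)
  rw [degree_eq] at this
  simp at this
  omega

/-- A bivariate polynomial of degree at most three, written out in its ten monomials. -/
lemma eval_eq_of_totalDegree_le_three {p : MvPolynomial (Fin 2) ℝ} (hp : p.totalDegree ≤ 3)
    (v : Fin 2 → ℝ) :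
    eval v p = coeff (bidegree 0 0) p + coeff (bidegree 1 0) p * v 0 + coeff (bidegree 0 1) p * v 1
      + coeff (bidegree 2 0) p * v 0 ^ 2 + coeff (bidegree 1 1) p * (v 0 * v 1)
      + coeff (bidegree 0 2) p * v 1 ^ 2 + coeff (bidegree 3 0) p * v 0 ^ 3
      + coeff (bidegree 2 1) p * (v 0 ^ 2 * v 1) + coeff (bidegree 1 2) p * (v 0 * v 1 ^ 2)
      + coeff (bidegree 0 3) p * v 1 ^ 3 := by
  classical
  have key : eval v p = ∑ x ∈ Finset.range 4 ×ˢ Finset.range 4,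
      coeff (bidegree x.1 x.2) p * (v 0 ^ x.1 * v 1 ^ x.2) := by
    have hinj : Set.InjOn (fun x : ℕ × ℕ => bidegree x.1 x.2)
        (Finset.range 4 ×ˢ Finset.range 4 : Finset (ℕ × ℕ)) := by
      intro a _ b _ h
      exact Prod.ext_iff.mpr (bidegree_inj.mp h)
    rw [eval_eq']
    simp only [Fin.prod_univ_two]
    rw [Finset.sum_subset (s₂ := (Finset.range 4 ×ˢ Finset.range 4).image
      (fun x : ℕ × ℕ => bidegree x.1 x.2)), Finset.sum_image hinj]
    · simp
    · intro d hd
      have := le_totalDegree hd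
      rw [degree_eq] at this
      simp only [Finset.mem_image, Finset.mem_product, Finset.mem_range]
      exact ⟨(d 0, d 1), ⟨by simp only; omega, by simp only; omega⟩, bidegree_self d⟩
    · intro d _ hd
      rw [notMem_support_iff.mp hd, zero_mul]
  rw [key, Finset.sum_product]
  simp only [Finset.sum_range_succ, Finset.sum_range_zero]
  rw [coeff_bidegree_eq_zero (i := 1) (j := 3) hp (by norm_num),
    coeff_bidegree_eq_zero (i := 2) (j := 2) hp (by norm_num),
    coeff_bidegree_eq_zero (i := 2) (j := 3) hp (by norm_num),
    coeff_bidegree_eq_zero (i := 3) (j := 1) hp (by norm_num),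
    coeff_bidegree_eq_zero (i := 3) (j := 2) hp (by norm_num),
    coeff_bidegree_eq_zero (i := 3) (j := 3) hp (by norm_num)]
  ring

lemma contDiff_eval {n : ℕ} {m : WithTop ℕ∞} (p : MvPolynomial (Fin n) ℝ) :
    ContDiff ℝ m (fun v : Fin n → ℝ => eval v p) := by
  simp only [eval_eq']
  fun_prop

/-- A polynomial without monomials of degree at most `m` is `o(‖v‖ ^ m)` at the origin. -/
lemma isLittleO_eval {n m : ℕ} {p : MvPolynomial (Fin n) ℝ}
    (hp : ∀ d : Fin n →₀ ℕ, (d.sum fun _ e => e) ≤ m → coeff d p = 0) :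
    (fun v => eval v p) =o[𝓝 (0 : Fin n → ℝ)] (fun v => ‖v‖ ^ m) := by
  simp only [eval_eq']
  refine IsLittleO.fun_sum fun d hd => ?_
  refine IsLittleO.const_mul_left ?_ _
  have hlt : m < ∑ i, d i := by
    by_contra hle
    refine mem_support_iff.mp hd (hp d ?_)
    rw [Finsupp.sum_fintype _ _ (fun _ => rfl)]
    omega
  have hO : (fun v : Fin n → ℝ => ∏ i, v i ^ d i) =O[𝓝 0] (fun v => ‖v‖ ^ ∑ i, d i) := by
    refine IsBigO.of_bound 1 (Eventually.of_forall fun v => ?_)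
    rw [norm_prod, one_mul, norm_pow, norm_norm, ← Finset.prod_pow_eq_pow_sum]
    refine Finset.prod_le_prod (fun _ _ => norm_nonneg _) fun i _ => ?_
    rw [norm_pow]
    gcongr
    exact norm_le_pi_norm v i
  exact hO.trans_isLittleO
    ((isLittleO_pow_pow hlt).comp_tendsto tendsto_norm_zero)

/-- A univariate polynomial that is `o(s ^ n)` at `0` has no coefficients up to order `n`. -/
lemma coeff_eq_zero_of_isLittleO (n : ℕ) (P : Polynomial ℝ)
    (h : (fun s => P.eval s) =o[𝓝[≠] (0 : ℝ)] (fun s => s ^ n)) : ∀ k ≤ n, P.coeff k = 0 := by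
  induction n generalizing P with
  | zero =>
    intro k hk
    obtain rfl : k = 0 := by omega
    simp only [pow_zero, isLittleO_one_iff] at h
    have h2 : Tendsto (fun s => P.eval s) (𝓝[≠] (0 : ℝ)) (𝓝 (P.eval 0)) :=
      P.continuous.continuousAt.tendsto.mono_left nhdsWithin_le_nhds
    rw [Polynomial.coeff_zero_eq_eval_zero]
    exact tendsto_nhds_unique h2 h
  | succ n ih =>
    have hone : (fun s : ℝ => s ^ (n + 1)) =o[𝓝[≠] (0 : ℝ)] (fun _ => (1 : ℝ)) := by
      rw [isLittleO_one_iff]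
      have : Tendsto (fun s : ℝ => s ^ (n + 1)) (𝓝 0) (𝓝 (0 ^ (n + 1))) :=
        (continuous_pow (n + 1)).tendsto 0
      simpa using this.mono_left nhdsWithin_le_nhds
    have h0 : P.eval 0 = 0 := by
      have h1 := h.trans hone
      rw [isLittleO_one_iff] at h1
      exact tendsto_nhds_unique
        (P.continuous.continuousAt.tendsto.mono_left nhdsWithin_le_nhds) h1
    have hP : Polynomial.X * P.divX = P := by
      have := P.X_mul_divX_add
      rwa [Polynomial.coeff_zero_eq_eval_zero, h0, map_zero, add_zero] at this
    have hQ : (fun s => P.divX.eval s) =o[𝓝[≠] (0 : ℝ)] (fun s => s ^ n) := by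
      have h3 := (isBigO_refl (fun s : ℝ => s⁻¹) (𝓝[≠] (0 : ℝ))).mul_isLittleO h
      refine h3.congr' ?_ ?_
      · filter_upwards [self_mem_nhdsWithin] with s hs
        have hs0 : s ≠ 0 := hs
        have he : P.eval s = s * P.divX.eval s := by
          conv_lhs => rw [← hP, Polynomial.eval_mul, Polynomial.eval_X]
        rw [he, inv_mul_cancel_left₀ hs0]
      · filter_upwards [self_mem_nhdsWithin] with s hs
        have hs0 : s ≠ 0 := hs
        rw [pow_succ', inv_mul_cancel_left₀ hs0]
    intro k hk
    cases k with
    | zero => rw [Polynomial.coeff_zero_eq_eval_zero, h0]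
    | succ k => rw [← Polynomial.coeff_divX]; exact ih _ hQ k (by omega)

/-- A crude third order Taylor bound for a function with `g 0 = g'' 0 = 0`. -/
lemma abs_sub_linear_le {g g₁ g₂ g₃ : ℝ → ℝ} {r K : ℝ}
    (h₀ : ∀ x, HasDerivAt g (g₁ x) x) (h₁ : ∀ x, HasDerivAt g₁ (g₂ x) x)
    (h₂ : ∀ x, HasDerivAt g₂ (g₃ x) x) (hK : ∀ x ∈ Set.Icc 0 r, |g₃ x| ≤ K)
    (hg : g 0 = 0) (hg₂ : g₂ 0 = 0) {x : ℝ} (hx : x ∈ Set.Icc 0 r) :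
    |g x - g₁ 0 * x| ≤ K * x ^ 3 := by
  have mvt : ∀ {f f' : ℝ → ℝ} {C y : ℝ}, (∀ x, HasDerivAt f (f' x) x) → 0 ≤ y →
      (∀ z ∈ Set.Icc 0 y, |f' z| ≤ C) → |f y - f 0| ≤ C * y := by
    intro f f' C y hf hy hC
    have := (convex_Icc (0 : ℝ) y).norm_image_sub_le_of_norm_hasDerivWithin_le
      (fun z _ => (hf z).hasDerivWithinAt) hC (Set.left_mem_Icc.mpr hy) (Set.right_mem_Icc.mpr hy)
    simpa [abs_of_nonneg hy] using this
  have hK0 : 0 ≤ K := (abs_nonneg _).trans (hK x hx)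
  have b₂ : ∀ y ∈ Set.Icc 0 r, |g₂ y| ≤ K * y := fun y hy => by
    simpa [hg₂] using mvt h₂ hy.1 fun z hz => hK z ⟨hz.1, hz.2.trans hy.2⟩
  have b₁ : ∀ y ∈ Set.Icc 0 r, |g₁ y - g₁ 0| ≤ K * y * y := fun y hy =>
    mvt h₁ hy.1 fun z hz => (b₂ z ⟨hz.1, hz.2.trans hy.2⟩).trans
      (mul_le_mul_of_nonneg_left hz.2 hK0)
  have b₀ := mvt (f := fun y => g y - g₁ 0 * y) (f' := fun y => g₁ y - g₁ 0) (C := K * x * x)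
    (fun y => ((h₀ y).fun_sub ((hasDerivAt_id' y).const_mul (g₁ 0))).congr_deriv (by simp)) hx.1
    (fun z hz => (b₁ z ⟨hz.1, hz.2.trans hx.2⟩).trans (by
      have h0x : 0 ≤ K * x := mul_nonneg hK0 hx.1
      have h0z := hz.1
      have hzx := hz.2
      gcongr))
  simp only [hg, mul_zero, sub_zero] at b₀
  calc _ ≤ K * x * x * x := b₀
    _ = K * x ^ 3 := by ring

/-- The partial derivative in the first coordinate. -/
noncomputable def partialX (F : (Fin 2 → ℝ) → ℝ) (v : Fin 2 → ℝ) : ℝ := fderiv ℝ F v ![1, 0]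

lemma contDiff_partialX {F : (Fin 2 → ℝ) → ℝ} {n : ℕ} (hF : ContDiff ℝ (n + 1 : ℕ) F) :
    ContDiff ℝ n (partialX F) := by
  have h : ContDiff ℝ n (fderiv ℝ F) := hF.fderiv_right (by push_cast; exact le_rfl)
  exact h.clm_apply contDiff_const

lemma hasDerivAt_slice {F : (Fin 2 → ℝ) → ℝ} (hF : Differentiable ℝ F) (x y : ℝ) :
    HasDerivAt (fun x => F ![x, y]) (partialX F ![x, y]) x := by
  have h : HasDerivAt (fun x : ℝ => ![x, y]) ![1, 0] x := by
    rw [hasDerivAt_pi]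
    intro i
    fin_cases i
    · exact hasDerivAt_id' x
    · exact hasDerivAt_const x y
  exact (hF _).hasFDerivAt.comp_hasDerivAt x h

lemma hasDerivAt_slice_neg {F : (Fin 2 → ℝ) → ℝ} (hF : Differentiable ℝ F) (x y : ℝ) :
    HasDerivAt (fun x => F ![-x, y]) (-partialX F ![-x, y]) x := by
  exact ((hasDerivAt_slice hF (-x) y).scomp x (hasDerivAt_neg x)).congr_deriv (by simp)

lemma norm_pair_eq {x y : ℝ} (h : |x| ≤ y) : ‖(![x, y] : Fin 2 → ℝ)‖ = y := by
  have hy : 0 ≤ y := (abs_nonneg x).trans h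
  refine le_antisymm ((pi_norm_le_iff_of_nonneg hy).mpr fun i => ?_) ?_
  · fin_cases i
    · simpa using h
    · simp [abs_of_nonneg hy]
  · simpa [abs_of_nonneg hy] using norm_le_pi_norm (![x, y] : Fin 2 → ℝ) 1

/-- The odd part in `x` of a `C³` function is linear in `x` up to a uniform cubic error. -/
lemma exists_odd_part_bound {F : (Fin 2 → ℝ) → ℝ} (hF : ContDiff ℝ 3 F) :
    ∃ K : ℝ, 0 ≤ K ∧ ∀ y ≤ 1, ∃ l : ℝ, ∀ x ∈ Set.Icc 0 y,
      |F ![x, y] - F ![-x, y] - l * x| ≤ K * x ^ 3 := by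
  have h₀ : ContDiff ℝ (2 + 1 : ℕ) F := by exact_mod_cast hF
  have h₁ : ContDiff ℝ (1 + 1 : ℕ) (partialX F) := contDiff_partialX h₀
  have h₂ : ContDiff ℝ (0 + 1 : ℕ) (partialX (partialX F)) := contDiff_partialX h₁
  have h₃ : ContDiff ℝ (0 : ℕ) (partialX (partialX (partialX F))) := contDiff_partialX h₂
  have d₀ := h₀.differentiable (by norm_num)
  have d₁ := h₁.differentiable (by norm_num)
  have d₂ := h₂.differentiable (by norm_num)
  obtain ⟨M, hM⟩ := (isCompact_closedBall (0 : Fin 2 → ℝ) 1).exists_bound_of_continuousOn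
    h₃.continuous.continuousOn
  have hM0 : 0 ≤ M := (norm_nonneg _).trans (hM 0 (by simp))
  refine ⟨M + M, by positivity, fun y hy => ⟨partialX F ![0, y] + partialX F ![-0, y], ?_⟩⟩
  intro x hx
  refine abs_sub_linear_le (r := y)
    (g := fun x => F ![x, y] - F ![-x, y])
    (g₁ := fun x => partialX F ![x, y] + partialX F ![-x, y])
    (g₂ := fun x => partialX (partialX F) ![x, y] - partialX (partialX F) ![-x, y])
    (g₃ := fun x => partialX (partialX (partialX F)) ![x, y]
      + partialX (partialX (partialX F)) ![-x, y]) ?_ ?_ ?_ ?_ (by simp) (by simp) hx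
  · intro x
    exact ((hasDerivAt_slice d₀ x y).fun_sub (hasDerivAt_slice_neg d₀ x y)).congr_deriv (by ring)
  · intro x
    exact ((hasDerivAt_slice d₁ x y).fun_add (hasDerivAt_slice_neg d₁ x y)).congr_deriv (by ring)
  · intro x
    exact ((hasDerivAt_slice d₂ x y).fun_sub (hasDerivAt_slice_neg d₂ x y)).congr_deriv (by ring)
  · intro z hz
    refine (abs_add_le _ _).trans (add_le_add (hM _ ?_) (hM _ ?_))
    · rw [mem_closedBall_zero_iff, norm_pair_eq (by rw [abs_of_nonneg hz.1]; exact hz.2)]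
      exact hy
    · rw [mem_closedBall_zero_iff, norm_pair_eq (by rw [abs_neg, abs_of_nonneg hz.1]; exact hz.2)]
      exact hy

lemma coeff_relations {p : MvPolynomial (Fin 2) ℝ} (hp : p.totalDegree ≤ 3)
    (h : (fun s : ℝ => eval ![s ^ 3, s ^ 2] p) =o[𝓝 0] (fun s => s ^ 6)) :
    coeff (bidegree 0 0) p = 0 ∧ coeff (bidegree 1 0) p = 0 ∧ coeff (bidegree 0 1) p = 0 ∧
      coeff (bidegree 1 1) p = 0 ∧ coeff (bidegree 0 2) p = 0 ∧
      coeff (bidegree 2 0) p + coeff (bidegree 0 3) p = 0 := by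
  let P : Polynomial ℝ :=
    Polynomial.C (coeff (bidegree 0 0) p)
    + Polynomial.C (coeff (bidegree 0 1) p) * Polynomial.X ^ 2
    + Polynomial.C (coeff (bidegree 1 0) p) * Polynomial.X ^ 3
    + Polynomial.C (coeff (bidegree 0 2) p) * Polynomial.X ^ 4
    + Polynomial.C (coeff (bidegree 1 1) p) * Polynomial.X ^ 5
    + Polynomial.C (coeff (bidegree 2 0) p + coeff (bidegree 0 3) p) * Polynomial.X ^ 6
    + Polynomial.C (coeff (bidegree 1 2) p) * Polynomial.X ^ 7
    + Polynomial.C (coeff (bidegree 2 1) p) * Polynomial.X ^ 8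
    + Polynomial.C (coeff (bidegree 3 0) p) * Polynomial.X ^ 9
  have hP : (fun s => P.eval s) =o[𝓝[≠] (0 : ℝ)] (fun s => s ^ 6) := by
    refine (h.mono nhdsWithin_le_nhds).congr_left fun s => ?_
    rw [eval_eq_of_totalDegree_le_three hp]
    simp [P]
    ring
  have key := coeff_eq_zero_of_isLittleO 6 P hP
  have k0 := key 0 (by norm_num)
  have k2 := key 2 (by norm_num)
  have k3 := key 3 (by norm_num)
  have k4 := key 4 (by norm_num)
  have k5 := key 5 (by norm_num)
  have k6 := key 6 (by norm_num)
  simp [P, Polynomial.coeff_X_pow, Polynomial.coeff_C, -map_add] at k0 k2 k3 k4 k5 k6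
  exact ⟨k0, k3, k2, k5, k4, k6⟩

lemma isLittleO_on_cusp {p : MvPolynomial (Fin 2) ℝ} {F : (Fin 2 → ℝ) → ℝ}
    (hE : ∀ x ∈ {v : Fin 2 → ℝ | v 0 ^ 2 = v 1 ^ 3}, F x = 0)
    (ho : (fun v => F v - eval v p) =o[𝓝 (0 : Fin 2 → ℝ)] (fun v => ‖v‖ ^ 3)) :
    (fun s : ℝ => eval ![s ^ 3, s ^ 2] p) =o[𝓝 0] (fun s => s ^ 6) := by
  have ht : Tendsto (fun s : ℝ => ![s ^ 3, s ^ 2]) (𝓝 0) (𝓝 (0 : Fin 2 → ℝ)) := by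
    have hc : Continuous (fun s : ℝ => ![s ^ 3, s ^ 2]) := by fun_prop
    have := hc.tendsto 0
    have h0 : (![(0 : ℝ) ^ 3, 0 ^ 2] : Fin 2 → ℝ) = 0 := by
      ext i; fin_cases i <;> simp
    rwa [h0] at this
  have h := (ho.comp_tendsto ht).neg_left
  refine h.congr' ?_ ?_
  · refine Eventually.of_forall fun s => ?_
    have : F ![s ^ 3, s ^ 2] = 0 := hE _ (by simp; ring)
    simp [this]
  · filter_upwards [Metric.ball_mem_nhds (0 : ℝ) one_pos] with s hs
    have hs : |s| < 1 := by simpa using hs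
    have hle : |s ^ 3| ≤ s ^ 2 := by
      rw [abs_pow, ← sq_abs s]
      exact pow_le_pow_of_le_one (abs_nonneg s) hs.le (by norm_num)
    simp only [Function.comp_apply, norm_pair_eq hle]
    ring

/-- The coefficient of `x * y ^ 2` vanishes. -/
lemma coeff_one_two_eq_zero {p : MvPolynomial (Fin 2) ℝ} (hp : p.totalDegree ≤ 3)
    {F : (Fin 2 → ℝ) → ℝ} (hF : ContDiff ℝ 3 F)
    (hE : ∀ x ∈ {v : Fin 2 → ℝ | v 0 ^ 2 = v 1 ^ 3}, F x = 0)
    (ho : (fun v => F v - eval v p) =o[𝓝 (0 : Fin 2 → ℝ)] (fun v => ‖v‖ ^ 3))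
    (h10 : coeff (bidegree 1 0) p = 0) (h11 : coeff (bidegree 1 1) p = 0) :
    coeff (bidegree 1 2) p = 0 := by
  obtain ⟨K, hK0, hK⟩ := exists_odd_part_bound hF
  set b := coeff (bidegree 1 2) p
  set c := coeff (bidegree 3 0) p
  have key : ∀ ε : ℝ, 0 < ε → ε ≤ 1 → 2 * |b| ≤ (2 * K + 2 * |c| + 2) * ε ^ 2 := by
    intro ε hε hε1
    obtain ⟨δ, hδ, hball⟩ := Metric.eventually_nhds_iff.mp (ho.def (pow_pos hε 3))
    obtain ⟨s, hs, hsm⟩ := exists_between (show 0 < min (δ / 2) ε by positivity)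
    have hsε : s ≤ ε := (hsm.trans_le (min_le_right _ _)).le
    have hs1 : s ≤ 1 := hsε.trans hε1
    have hsδ : s < δ := by have := hsm.trans_le (min_le_left _ _); linarith
    have hs2 : s ^ 2 ≤ s := by nlinarith
    have hs2' : 0 < s ^ 2 := by positivity
    obtain ⟨l, hl⟩ := hK (s ^ 2) (hs2.trans hs1)
    have hl' : |l| ≤ K * s ^ 6 := by
      have h := hl (s ^ 3) ⟨by positivity, pow_le_pow_of_le_one hs.le hs1 (by norm_num)⟩
      have e1 : F ![s ^ 3, s ^ 2] = 0 := hE _ (by simp; ring)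
      have e2 : F ![-s ^ 3, s ^ 2] = 0 := hE _ (by simp; ring)
      rw [e1, e2, sub_zero, zero_sub, abs_neg, abs_mul, abs_of_pos (pow_pos hs 3)] at h
      refine le_of_mul_le_mul_right ?_ (pow_pos hs 3)
      calc _ ≤ _ := h
        _ = _ := by ring
    have hx0 : 0 ≤ ε * s ^ 2 := by positivity
    have hx1 : ε * s ^ 2 ≤ s ^ 2 := by nlinarith
    have hx := hl (ε * s ^ 2) ⟨hx0, hx1⟩
    have n1 : ‖(![ε * s ^ 2, s ^ 2] : Fin 2 → ℝ)‖ = s ^ 2 :=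
      norm_pair_eq (by rwa [abs_of_nonneg hx0])
    have n2 : ‖(![-(ε * s ^ 2), s ^ 2] : Fin 2 → ℝ)‖ = s ^ 2 :=
      norm_pair_eq (by rwa [abs_neg, abs_of_nonneg hx0])
    have r1 := hball (y := ![ε * s ^ 2, s ^ 2]) (by rw [dist_zero_right, n1]; linarith)
    have r2 := hball (y := ![-(ε * s ^ 2), s ^ 2]) (by rw [dist_zero_right, n2]; linarith)
    rw [n1, Real.norm_eq_abs, Real.norm_eq_abs, abs_of_pos (pow_pos hs2' 3)] at r1
    rw [n2, Real.norm_eq_abs, Real.norm_eq_abs, abs_of_pos (pow_pos hs2' 3)] at r2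
    have hdiff : eval ![ε * s ^ 2, s ^ 2] p - eval ![-(ε * s ^ 2), s ^ 2] p
        = (2 * b) * (ε * s ^ 6) + 2 * c * (ε ^ 3 * s ^ 6) := by
      rw [eval_eq_of_totalDegree_le_three hp, eval_eq_of_totalDegree_le_three hp, h10, h11]
      simp
      ring
    have hlx : |l * (ε * s ^ 2)| ≤ K * (ε ^ 3 * s ^ 6) := by
      rw [abs_mul, abs_of_nonneg hx0]
      calc |l| * (ε * s ^ 2) ≤ (K * s ^ 6) * (ε * ε ^ 2) := by gcongr
        _ = _ := by ring
    have hcx : |2 * c * (ε ^ 3 * s ^ 6)| = 2 * |c| * (ε ^ 3 * s ^ 6) := by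
      rw [abs_mul, abs_mul, abs_two, abs_of_pos (show 0 < ε ^ 3 * s ^ 6 by positivity)]
    have hbx : |2 * b * (ε * s ^ 6)| = 2 * |b| * (ε * s ^ 6) := by
      rw [abs_mul, abs_mul, abs_two, abs_of_pos (show 0 < ε * s ^ 6 by positivity)]
    have hfin : 2 * |b| * (ε * s ^ 6) ≤ (2 * K + 2 * |c| + 2) * ε ^ 2 * (ε * s ^ 6) := by
      have e : (2 * b) * (ε * s ^ 6) =
          (F ![ε * s ^ 2, s ^ 2] - F ![-(ε * s ^ 2), s ^ 2] - l * (ε * s ^ 2))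
          + l * (ε * s ^ 2) - (F ![ε * s ^ 2, s ^ 2] - eval ![ε * s ^ 2, s ^ 2] p)
          + (F ![-(ε * s ^ 2), s ^ 2] - eval ![-(ε * s ^ 2), s ^ 2] p)
          - 2 * c * (ε ^ 3 * s ^ 6) := by linear_combination -hdiff
      have hcx' := hcx.le
      rw [← hbx, e]
      rw [abs_le] at *
      constructor <;> ring_nf at * <;> linarith
    exact le_of_mul_le_mul_right hfin (by positivity)
  have hlim : Tendsto (fun ε : ℝ => (2 * K + 2 * |c| + 2) * ε ^ 2) (𝓝[>] 0) (𝓝 0) := by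
    have hc : Continuous (fun ε : ℝ => (2 * K + 2 * |c| + 2) * ε ^ 2) := by fun_prop
    simpa using (hc.tendsto 0).mono_left (nhdsWithin_le_nhds (s := Set.Ioi 0))
  have hb : 2 * |b| ≤ 0 := by
    refine ge_of_tendsto hlim ?_
    filter_upwards [Ioc_mem_nhdsGT (zero_lt_one' ℝ)] with ε hε
    exact key ε hε.1 hε.2
  exact abs_nonpos_iff.mp (by linarith)

lemma monomial_bidegree (i j : ℕ) (a : ℝ) :
    monomial (bidegree i j) a = C a * X 0 ^ i * X 1 ^ j := by
  rw [bidegree, X_pow_eq_monomial, X_pow_eq_monomial, C_mul_monomial, monomial_mul]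
  simp

/-- The product of the cusp equation with a polynomial of degree one, as a sum of monomials. -/
lemma linear_mul_cusp (a b c : ℝ) :
    (C a + C b * X 1 + C c * X 0) * (X 0 ^ 2 - X 1 ^ 3 : MvPolynomial (Fin 2) ℝ) =
      monomial (bidegree 2 0) a - monomial (bidegree 0 3) a + monomial (bidegree 2 1) b
      - monomial (bidegree 0 4) b + monomial (bidegree 3 0) c - monomial (bidegree 1 3) c := by
  simp only [monomial_bidegree]
  ring

end CuspIdeal

open CuspIdeal in
/-- For `E = {x² = y³} ⊆ ℝ²` one has `I³(E) = ⟨x² − y³⟩₃`. -/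
theorem stmt18 :
    Im 2 3 {v : Fin 2 → ℝ | v 0 ^ 2 = v 1 ^ 3} =
      truncIdeal 2 3 (fun _ : Fin 1 => (X 0 ^ 2 - X 1 ^ 3 : MvPolynomial (Fin 2) ℝ)) := by
  ext p
  constructor
  · rintro ⟨hp, F, hF, hE, ho⟩
    obtain ⟨h00, h10, h01, h11, h02, h6⟩ := coeff_relations hp (isLittleO_on_cusp hE ho)
    have h12 := coeff_one_two_eq_zero hp (by exact_mod_cast hF) hE ho h10 h11
    refine ⟨hp, fun _ => C (coeff (bidegree 2 0) p) + C (coeff (bidegree 2 1) p) * X 1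
      + C (coeff (bidegree 3 0) p) * X 0, fun d hd => ?_⟩
    rw [degree_eq] at hd
    rw [← bidegree_self d]
    generalize d 0 = i at *
    generalize d 1 = j at *
    have hi : i ≤ 3 := by omega
    have hj : j ≤ 3 := by omega
    simp only [Finset.univ_unique, Finset.sum_singleton, linear_mul_cusp, coeff_sub, coeff_add,
      coeff_monomial, bidegree_inj]
    interval_cases i <;> interval_cases j <;> first | omega | (simp [*]; done) | (simp; linarith)
  · rintro ⟨hp, q, hq⟩
    refine ⟨hp, fun v => eval v (q 0) * (v 0 ^ 2 - v 1 ^ 3), ?_, ?_, ?_⟩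
    · exact (contDiff_eval (q 0)).mul (by fun_prop)
    · intro v hv
      have hv : v 0 ^ 2 = v 1 ^ 3 := hv
      simp [hv]
    · refine (isLittleO_eval hq).neg_left.congr_left fun v => ?_
      simp
end

section
/- Let E = {(x,y,z) ∈ ℝ³ : xy = yz = xz = 0} (the union of the three coordinate axes). Then I²(E) = ⟨xy, yz, xz⟩₂. -/
open MvPolynomial Filter Asymptotics Topology

/-- A univariate polynomial which is `o(t ^ m)` at the origin is divisible by `X ^ (m + 1)`. -/
theorem Polynomial.X_pow_dvd_of_isLittleO {g : Polynomial ℝ} {m : ℕ}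
    (h : (fun t => g.eval t) =o[𝓝 (0 : ℝ)] (fun t => t ^ m)) :
    ∀ j ≤ m + 1, Polynomial.X ^ j ∣ g := by
  intro j
  induction j with
  | zero => simp
  | succ j ih =>
    intro hj
    obtain ⟨r, rfl⟩ := ih (by omega)
    have hle : (fun t : ℝ => t ^ m) =O[𝓝 0] (fun t => t ^ j) :=
      IsBigO.of_bound 1 ?_
    · have h1 := (h.trans_isBigO hle).mono (nhdsWithin_le_nhds (s := {0}ᶜ))
      have h2 : Tendsto (fun t => r.eval t) (𝓝[≠] (0 : ℝ)) (𝓝 0) := by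
        refine h1.tendsto_div_nhds_zero.congr' ?_
        filter_upwards [self_mem_nhdsWithin] with t ht
        have ht : t ≠ 0 := ht
        simp only [Polynomial.eval_mul, Polynomial.eval_pow, Polynomial.eval_X]
        field_simp
      have h3 : r.eval 0 = 0 :=
        tendsto_nhds_unique (r.continuous.continuousAt.tendsto.mono_left nhdsWithin_le_nhds) h2
      rw [pow_succ]
      refine mul_dvd_mul_left _ (Polynomial.X_dvd_iff.2 ?_)
      rwa [Polynomial.coeff_zero_eq_eval_zero]
    · filter_upwards [Metric.closedBall_mem_nhds (0 : ℝ) one_pos] with t ht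
      rw [norm_pow, norm_pow, one_mul]
      exact pow_le_pow_of_le_one (norm_nonneg t) (by simpa using ht) (by omega)

/-- The coefficients of the restriction of a polynomial to a coordinate axis. -/
theorem MvPolynomial.coeff_aeval_single_X {n : ℕ} (i : Fin n) (k : ℕ)
    (p : MvPolynomial (Fin n) ℝ) :
    (aeval (Pi.single i Polynomial.X : Fin n → Polynomial ℝ) p).coeff k =
      coeff (Finsupp.single i k) p := by
  induction p using MvPolynomial.induction_on' with
  | add p q hp hq => simp [hp, hq]
  | monomial d a =>
    rw [aeval_monomial, coeff_monomial, Finsupp.prod_fintype _ _ (by simp),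
      Polynomial.algebraMap_eq, Polynomial.coeff_C_mul]
    by_cases hd : ∀ j, j ≠ i → d j = 0
    · have hds : d = Finsupp.single i (d i) := by
        ext j
        rcases eq_or_ne j i with rfl | hj
        · simp
        · simp [hd j hj, hj.symm]
      rw [Finset.prod_eq_single i (fun j _ hj => by simp [hd j hj]) (by simp), Pi.single_eq_same,
        Polynomial.coeff_X_pow, hds]
      simp [(Finsupp.single_injective i).eq_iff, eq_comm]
    · push Not at hd
      obtain ⟨j, hj, hdj⟩ := hd
      rw [Finset.prod_eq_zero (Finset.mem_univ j) (by simp [hj, hdj]), if_neg]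
      · simp
      · rintro rfl
        simp [hj.symm] at hdj

theorem MvPolynomial.eval_aeval_single_X {n : ℕ} (i : Fin n) (t : ℝ)
    (p : MvPolynomial (Fin n) ℝ) :
    (aeval (Pi.single i Polynomial.X : Fin n → Polynomial ℝ) p).eval t =
      eval (Pi.single i t) p := by
  rw [← Polynomial.coe_evalRingHom, map_aeval, ← eval₂_id]
  have hC : (Polynomial.evalRingHom t).comp (algebraMap ℝ (Polynomial ℝ)) = RingHom.id ℝ := by
    ext; simp
  rw [hC]
  change eval₂ _ _ _ = _
  congr 1
  ext j
  rcases eq_or_ne j i with rfl | hj <;> simp [*]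

/-- If `E` contains a coordinate axis, then the polynomials in `Iᵐ(E)` have no pure powers of
the corresponding variable. -/
theorem coeff_single_eq_zero_of_mem_Im {n m : ℕ} {E : Set (Fin n → ℝ)}
    {p : MvPolynomial (Fin n) ℝ} (hp : p ∈ Im n m E) {i : Fin n}
    (hE : ∀ t : ℝ, Pi.single i t ∈ E) {k : ℕ} (hk : k ≤ m) :
    coeff (Finsupp.single i k) p = 0 := by
  obtain ⟨-, F, -, hF, ho⟩ := hp
  have htend : Tendsto (fun t : ℝ => (Pi.single i t : Fin n → ℝ)) (𝓝 0) (𝓝 0) := by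
    have := (continuous_single (A := fun _ : Fin n => ℝ) i).tendsto 0
    simpa using this
  have h1 := ho.comp_tendsto htend
  have h2 : (fun t => (aeval (Pi.single i Polynomial.X : Fin n → Polynomial ℝ) p).eval t)
      =o[𝓝 (0 : ℝ)] (fun t => t ^ m) := by
    rw [← isLittleO_neg_left, ← isLittleO_norm_right]
    refine h1.congr (fun t => ?_) (fun t => ?_)
    · simp [hF _ (hE t), eval_aeval_single_X]
    · simp [Pi.norm_single]
  rw [← coeff_aeval_single_X]
  exact Polynomial.X_pow_dvd_iff.1 (Polynomial.X_pow_dvd_of_isLittleO h2 _ le_rfl) k (by omega)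

/-- A product of two distinct variables divides no pure power. -/
theorem MvPolynomial.coeff_single_mul_X_mul_X {σ : Type*} {R : Type*} [CommSemiring R]
    {a b : σ} (hab : a ≠ b) (q : MvPolynomial σ R) (i : σ) (k : ℕ) :
    coeff (Finsupp.single i k) (q * (X a * X b)) = 0 := by
  classical
  rw [← mul_assoc, coeff_mul_X']
  split_ifs with hb
  · rw [coeff_mul_X', if_neg]
    intro ha
    obtain rfl : i = b := by
      by_contra h
      simp [h] at hb
    simp [hab] at ha
  · rfl

/-- For the union of the three coordinate axes `E = {xy = yz = xz = 0} ⊆ ℝ³`,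
one has `I²(E) = ⟨xy, yz, xz⟩₂`. -/
theorem stmt19 :
    Im 3 2 {v : Fin 3 → ℝ | v 0 * v 1 = 0 ∧ v 1 * v 2 = 0 ∧ v 0 * v 2 = 0} =
      truncIdeal 3 2
        ![(X 0 * X 1 : MvPolynomial (Fin 3) ℝ), X 1 * X 2, X 0 * X 2] := by
  ext p
  constructor
  · intro hp
    refine ⟨hp.1, ![C (coeff (Finsupp.single 0 1 + Finsupp.single 1 1) p),
      C (coeff (Finsupp.single 1 1 + Finsupp.single 2 1) p),
      C (coeff (Finsupp.single 0 1 + Finsupp.single 2 1) p)], fun d hd => ?_⟩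
    have hX (a b : Fin 3) : (X a * X b : MvPolynomial (Fin 3) ℝ) =
        monomial (Finsupp.single a 1 + Finsupp.single b 1) 1 := by
      simp [X, monomial_mul]
    by_cases hs : ∃ i k, d = Finsupp.single i k
    · obtain ⟨i, k, rfl⟩ := hs
      have hk : k ≤ 2 := by simpa using hd
      have h0 := coeff_single_eq_zero_of_mem_Im hp (i := i)
        (fun t => by fin_cases i <;> simp) hk
      simp only [Fin.sum_univ_three, coeff_sub, coeff_add, h0]
      simp only [Matrix.cons_val]
      simp only [coeff_single_mul_X_mul_X, ne_eq, Fin.reduceEq, not_false_eq_true, add_zero,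
        sub_zero]
    · rw [Finsupp.sum_fintype _ _ (by simp), Fin.sum_univ_three] at hd
      have hcases : (d 0 = 1 ∧ d 1 = 1 ∧ d 2 = 0) ∨ (d 0 = 0 ∧ d 1 = 1 ∧ d 2 = 1) ∨
          (d 0 = 1 ∧ d 1 = 0 ∧ d 2 = 1) := by
        by_contra hc
        have h0 : ¬ (d 1 = 0 ∧ d 2 = 0) := fun h => hs ⟨0, d 0, by
          ext j; fin_cases j <;> simp [h]⟩
        have h1 : ¬ (d 0 = 0 ∧ d 2 = 0) := fun h => hs ⟨1, d 1, by
          ext j; fin_cases j <;> simp [h]⟩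
        have h2 : ¬ (d 0 = 0 ∧ d 1 = 0) := fun h => hs ⟨2, d 2, by
          ext j; fin_cases j <;> simp [h]⟩
        omega
      have hd' : d = Finsupp.single 0 1 + Finsupp.single 1 1 ∨
          d = Finsupp.single 1 1 + Finsupp.single 2 1 ∨
          d = Finsupp.single 0 1 + Finsupp.single 2 1 := by
        refine hcases.imp ?_ (Or.imp ?_ ?_) <;>
        · rintro ⟨h0, h1, h2⟩
          ext j
          fin_cases j <;> simp [h0, h1, h2]
      rcases hd' with rfl | rfl | rfl <;>
        simp [Fin.sum_univ_three, hX, coeff_C_mul, coeff_monomial, DFunLike.ext_iff,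
          Fin.forall_fin_succ]
  · rintro ⟨hdeg, q, hq⟩
    have hcoeff (i : Fin 3) (k : ℕ) : coeff (Finsupp.single i k) p = 0 := by
      by_cases hk : k ≤ 2
      · simpa [Fin.sum_univ_three, coeff_single_mul_X_mul_X] using
          hq (Finsupp.single i k) (by simpa using hk)
      · exact coeff_eq_zero_of_totalDegree_lt (by
          rcases eq_or_ne k 0 with rfl | h0
          · omega
          · rw [Finsupp.support_single _ h0]; simp; omega)
    refine ⟨hdeg, fun v => eval v p, ?_, ?_, ?_⟩
    · exact (AnalyticOnNhd.eval_mvPolynomial p).contDiff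
    · have hsingle (i : Fin 3) (t : ℝ) : eval (Pi.single i t) p = 0 := by
        rw [← eval_aeval_single_X, show aeval _ p = (0 : Polynomial ℝ) from
          Polynomial.ext fun k => by rw [coeff_aeval_single_X, hcoeff, Polynomial.coeff_zero]]
        simp
      rintro v ⟨h01, h12, h02⟩
      have hv : ∃ i t, v = Pi.single i t := by
        have : (v 1 = 0 ∧ v 2 = 0) ∨ (v 0 = 0 ∧ v 2 = 0) ∨ (v 0 = 0 ∧ v 1 = 0) := by
          simp only [mul_eq_zero] at h01 h12 h02
          tauto
        rcases this with h | h | h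
        · exact ⟨0, v 0, by ext j; fin_cases j <;> simp [h]⟩
        · exact ⟨1, v 1, by ext j; fin_cases j <;> simp [h]⟩
        · exact ⟨2, v 2, by ext j; fin_cases j <;> simp [h]⟩
      obtain ⟨i, t, rfl⟩ := hv
      exact hsingle i t
    · simp
end
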